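/- arXiv:math/0408214 — 2 statements merged into one kernel-verified Lean document; each statement's English description precedes it below -/
import Mathlib

section
/- Let p be a prime and n a positive integer. There exists η ∈ ℚ_p such that for every sequence (k_j)_{j≥0} of positive integers satisfying: (i) k_j → ∞ (in ℝ), (ii) ‖k_j + n‖_p → 0, and (iii) 2k_j ≡ −2n (mod p−1) for all j, the sequence of rational numbers −(1 − p^{2k_j − 1})·B_{2k_j}/(2k_j), viewed in ℚ_p, converges to η. (This common limit is the value ζ_p(1+2n) of the Kubota–Leopoldt p-adic zeta function.) -/
open Filter Topology Finset in
/-- The truncated Faulhaber polynomial. -/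
lemma faul (p : ℕ) [Fact p.Prime] (m : ℕ) : ∃ P : ℚ_[p] → ℚ_[p], Continuous P ∧
    P 0 = ((bernoulli m : ℚ) : ℚ_[p]) ∧
    ∀ x : ℕ, ∑ a ∈ range x, (a : ℚ_[p]) ^ m = x * P x := by
  refine ⟨fun x => ∑ i ∈ range (m + 1), ((bernoulli i : ℚ) : ℚ_[p]) * ((m + 1).choose i : ℚ_[p])
    * x ^ (m - i) / (m + 1), by fun_prop, ?_, ?_⟩
  · simp only
    rw [Finset.sum_eq_single m]
    · have : (m : ℚ_[p]) + 1 ≠ 0 := by exact_mod_cast Nat.succ_ne_zero m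
      simp
      field_simp
    · intro i hi him
      have : m - i ≠ 0 := by have := Finset.mem_range.1 hi; omega
      simp [this]
    · simp
  · intro x
    have h := congrArg (fun q : ℚ => (q : ℚ_[p])) (sum_range_pow x m)
    push_cast at h
    rw [h, Finset.mul_sum]
    refine Finset.sum_congr rfl fun i hi => ?_
    have : m + 1 - i = (m - i) + 1 := by have := Finset.mem_range.1 hi; omega
    rw [this, pow_succ]
    ring

/-- Units below `p ^ N`. -/
def unitsBelow (p N : ℕ) : Finset ℕ := (Finset.range (p ^ N)).filter (fun a => ¬ p ∣ a)

/-- Power sum over units. -/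
def unitSum (p N m : ℕ) : ℕ := ∑ a ∈ unitsBelow p N, a ^ m

/-- The integral sum approximating the regularised zeta value. -/
def regSum (p N c m : ℕ) : ℕ :=
  ∑ a ∈ unitsBelow p N, (c * a / p ^ N) * (c * a % p ^ N) ^ (m - 1)

lemma unitSum_add (p : ℕ) [hp : Fact p.Prime] (N m : ℕ) :
    unitSum p (N + 1) m + p ^ m * ∑ a ∈ Finset.range (p ^ N), a ^ m
      = ∑ a ∈ Finset.range (p ^ (N + 1)), a ^ m := by
  have hp0 := hp.out.pos
  rw [← Finset.sum_filter_add_sum_filter_not (Finset.range (p ^ (N + 1))) (fun a => ¬ p ∣ a)]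
  unfold unitSum unitsBelow
  congr 1
  rw [Finset.mul_sum]
  refine Finset.sum_bij (fun a _ => p * a) ?_ ?_ ?_ ?_
  · intro a ha
    simp only [Finset.mem_range, Finset.mem_filter, not_not] at *
    refine ⟨?_, dvd_mul_right _ _⟩
    rw [pow_succ']
    exact Nat.mul_lt_mul_of_pos_left ha hp0
  · intro a _ b _ h
    exact Nat.eq_of_mul_eq_mul_left hp0 h
  · intro b hb
    simp only [Finset.mem_range, Finset.mem_filter, not_not] at hb
    obtain ⟨h1, a, rfl⟩ := hb
    refine ⟨a, ?_, rfl⟩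
    rw [pow_succ'] at h1
    exact Finset.mem_range.2 (Nat.lt_of_mul_lt_mul_left h1)
  · intro a _
    rw [mul_pow]

open Filter Topology in
lemma tendsto_p (p : ℕ) [hp : Fact p.Prime] :
    Tendsto (fun N : ℕ => (p : ℚ_[p]) ^ N) atTop (𝓝 0) :=
  tendsto_pow_atTop_nhds_zero_of_norm_lt_one Padic.norm_p_lt_one

open Filter Topology in
lemma tendsto_unitSum (p : ℕ) [hp : Fact p.Prime] (m : ℕ) (hm : 0 < m) :
    Tendsto (fun N : ℕ => (unitSum p (N + 1) m : ℚ_[p]) / (p : ℚ_[p]) ^ (N + 1)) atTop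
      (𝓝 ((1 - (p : ℚ_[p]) ^ (m - 1)) * ((bernoulli m : ℚ) : ℚ_[p]))) := by
  obtain ⟨P, hP, hP0, hPs⟩ := faul p m
  have hp0 : (p : ℚ_[p]) ≠ 0 := by exact_mod_cast hp.out.ne_zero
  have key : ∀ N : ℕ, (unitSum p (N + 1) m : ℚ_[p]) / (p : ℚ_[p]) ^ (N + 1)
      = P ((p : ℚ_[p]) ^ (N + 1)) - (p : ℚ_[p]) ^ (m - 1) * P ((p : ℚ_[p]) ^ N) := by
    intro N
    have h := congrArg (fun q : ℕ => (q : ℚ_[p])) (unitSum_add p N m)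
    push_cast at h
    have h1 := hPs (p ^ N)
    have h2 := hPs (p ^ (N + 1))
    push_cast at h1 h2
    rw [h1, h2] at h
    rw [div_eq_iff (pow_ne_zero _ hp0), eq_sub_of_add_eq h]
    obtain ⟨l, rfl⟩ := Nat.exists_eq_succ_of_ne_zero hm.ne'
    simp only [Nat.succ_eq_add_one, Nat.add_sub_cancel]
    ring
  simp_rw [key]
  have t := tendsto_p p
  have h0 : Tendsto (fun N : ℕ => P ((p : ℚ_[p]) ^ N)) atTop (𝓝 (P 0)) :=
    (hP.tendsto 0).comp t
  have h1 : Tendsto (fun N : ℕ => P ((p : ℚ_[p]) ^ (N + 1))) atTop (𝓝 (P 0)) :=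
    h0.comp (tendsto_add_atTop_nat 1)
  have := h1.sub (h0.const_mul ((p : ℚ_[p]) ^ (m - 1)))
  rw [← hP0]
  convert this using 2
  ring

lemma not_dvd_mod (p : ℕ) [hp : Fact p.Prime] (N c a : ℕ) (hc : ¬ p ∣ c) (ha : ¬ p ∣ a)
    (hN : N ≠ 0) : ¬ p ∣ c * a % p ^ N := by
  rw [Nat.dvd_mod_iff (dvd_pow_self p hN), hp.out.dvd_mul]
  tauto

lemma sum_perm (p : ℕ) [hp : Fact p.Prime] (N c : ℕ) (hc : ¬ p ∣ c) (hN : N ≠ 0) (m : ℕ) :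
    ∑ a ∈ unitsBelow p N, (c * a % p ^ N) ^ m = unitSum p N m := by
  have hinj : Set.InjOn (fun a => c * a % p ^ N) (unitsBelow p N) := by
    intro a ha b hb h
    simp only [unitsBelow, Finset.coe_filter, Finset.mem_range, Set.mem_ofPred_eq] at ha hb
    have hco : Nat.Coprime (p ^ N) c :=
      Nat.Coprime.pow_left _ ((Nat.Prime.coprime_iff_not_dvd hp.out).2 hc)
    have h' : c * a ≡ c * b [MOD p ^ N] := h
    exact Nat.ModEq.eq_of_lt_of_lt (Nat.ModEq.cancel_left_of_coprime hco h') ha.1 hb.1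
  have himg : (unitsBelow p N).image (fun a => c * a % p ^ N) = unitsBelow p N := by
    apply Finset.eq_of_subset_of_card_le
    · intro b hb
      obtain ⟨a, ha, rfl⟩ := Finset.mem_image.1 hb
      simp only [unitsBelow, Finset.mem_filter, Finset.mem_range] at ha ⊢
      exact ⟨Nat.mod_lt _ (pow_pos hp.out.pos _), not_dvd_mod p N c a hc ha.2 hN⟩
    · rw [Finset.card_image_of_injOn hinj]
  rw [unitSum, ← Finset.sum_image (f := fun b => b ^ m) hinj, himg]

lemma key_cong (p : ℕ) [hp : Fact p.Prime] (N c : ℕ) (hc : ¬ p ∣ c) (hN : N ≠ 0) (m : ℕ) :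
    ∃ K : ℕ, c ^ m * unitSum p N m
      = unitSum p N m + m * p ^ N * regSum p N c m + (p ^ N) ^ 2 * K := by
  have h : ∀ a : ℕ, ∃ k : ℕ, (c * a) ^ m = (c * a % p ^ N) ^ m
      + m * p ^ N * ((c * a / p ^ N) * (c * a % p ^ N) ^ (m - 1)) + (p ^ N) ^ 2 * k := by
    intro a
    obtain ⟨k, hk⟩ := Polynomial.powAddExpansion (c * a % p ^ N) (p ^ N * (c * a / p ^ N)) m
    refine ⟨k * (c * a / p ^ N) ^ 2, ?_⟩
    rw [Nat.mod_add_div] at hk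
    rw [hk]
    push_cast
    ring
  choose k hk using h
  refine ⟨∑ a ∈ unitsBelow p N, k a, ?_⟩
  rw [← sum_perm p N c hc hN m, sum_perm p N c hc hN m, regSum, unitSum, Finset.mul_sum,
    Finset.mul_sum, Finset.mul_sum]
  simp_rw [← mul_pow, hk, Finset.sum_add_distrib]
  rw [sum_perm p N c hc hN m, unitSum]

/-- The regularised value. -/
noncomputable def regVal (p : ℕ) [Fact p.Prime] (c m : ℕ) : ℚ_[p] :=
  ((c : ℚ_[p]) ^ m - 1) * ((1 - (p : ℚ_[p]) ^ (m - 1)) * ((bernoulli m : ℚ) : ℚ_[p])) / m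

open Filter Topology in
lemma tendsto_regSum (p : ℕ) [hp : Fact p.Prime] (c : ℕ) (hc : ¬ p ∣ c) (m : ℕ) (hm : 0 < m) :
    Tendsto (fun N : ℕ => (regSum p (N + 1) c m : ℚ_[p])) atTop (𝓝 (regVal p c m)) := by
  have hp0 : (p : ℚ_[p]) ≠ 0 := by exact_mod_cast hp.out.ne_zero
  have hm0 : (m : ℚ_[p]) ≠ 0 := by exact_mod_cast hm.ne'
  choose K hK using fun N : ℕ => key_cong p (N + 1) c hc (Nat.succ_ne_zero N) m
  have e : ∀ N : ℕ, (regSum p (N + 1) c m : ℚ_[p]) = (((c : ℚ_[p]) ^ m - 1) *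
      ((unitSum p (N + 1) m : ℚ_[p]) / (p : ℚ_[p]) ^ (N + 1)) - (p : ℚ_[p]) ^ (N + 1) * K N) / m := by
    intro N
    have h := congrArg (fun q : ℕ => (q : ℚ_[p])) (hK N)
    push_cast at h
    rw [eq_div_iff hm0]
    have hpN := pow_ne_zero (N + 1) hp0
    field_simp
    linear_combination -h
  simp_rw [e]
  have t : Tendsto (fun N : ℕ => (p : ℚ_[p]) ^ (N + 1) * K N) atTop (𝓝 0) := by
    refine squeeze_zero_norm (a := fun N : ℕ => ‖(p : ℚ_[p]) ^ (N + 1)‖) (fun N => ?_) ?_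
    · rw [norm_mul]
      exact mul_le_of_le_one_right (norm_nonneg _) (by exact_mod_cast Padic.norm_int_le_one (K N : ℤ))
    · have := ((tendsto_p p).comp (tendsto_add_atTop_nat 1)).norm
      simpa using this
  have := (((tendsto_unitSum p m hm).const_mul ((c : ℚ_[p]) ^ m - 1)).sub t).div_const (m : ℚ_[p])
  simpa [regVal] using this

lemma pow_modEq (p : ℕ) [hp : Fact p.Prime] (e r a b : ℕ) (hr : ¬ p ∣ r)
    (h : a ≡ b [MOD Nat.totient (p ^ e)]) : r ^ a ≡ r ^ b [MOD p ^ e] := by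
  have hco : Nat.Coprime r (p ^ e) :=
    Nat.Coprime.pow_right _ ((Nat.Prime.coprime_iff_not_dvd hp.out).2 hr).symm
  rw [← ZMod.natCast_eq_natCast_iff]
  push_cast
  rw [← ZMod.coe_unitOfCoprime r hco, ← Units.val_pow_eq_pow_val, ← Units.val_pow_eq_pow_val]
  congr 1
  rw [pow_eq_pow_iff_modEq]
  exact h.of_dvd (orderOf_dvd_of_pow_eq_one (ZMod.pow_totient _))

lemma norm_sub_le_of_modEq (p : ℕ) [hp : Fact p.Prime] (e x y : ℕ) (h : x ≡ y [MOD p ^ e]) :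
    ‖(x : ℚ_[p]) - (y : ℚ_[p])‖ ≤ (p : ℝ) ^ (-(e : ℤ)) := by
  have h1 : ((p ^ e : ℕ) : ℤ) ∣ (x : ℤ) - (y : ℤ) := (Nat.modEq_iff_dvd.1 h.symm)
  have := (Padic.norm_int_le_pow_iff_dvd (p := p) ((x : ℤ) - y) e).2 (by exact_mod_cast h1)
  push_cast at this
  simpa using this

open Filter Topology in
lemma kummer (p : ℕ) [hp : Fact p.Prime] (c : ℕ) (hc : ¬ p ∣ c) (e m m' : ℕ) (hm : 0 < m)
    (hm' : 0 < m') (h : m ≡ m' [MOD Nat.totient (p ^ e)]) :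
    ‖regVal p c m - regVal p c m'‖ ≤ (p : ℝ) ^ (-(e : ℤ)) := by
  refine le_of_tendsto ((tendsto_regSum p c hc m hm).sub (tendsto_regSum p c hc m' hm')).norm
    (Eventually.of_forall fun N => ?_)
  apply norm_sub_le_of_modEq
  have h' : m - 1 ≡ m' - 1 [MOD Nat.totient (p ^ e)] := by
    apply Nat.ModEq.add_right_cancel' 1
    rwa [Nat.sub_add_cancel hm, Nat.sub_add_cancel hm']
  rw [← ZMod.natCast_eq_natCast_iff]
  unfold regSum
  push_cast
  refine Finset.sum_congr rfl fun a ha => ?_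
  simp only [unitsBelow, Finset.mem_filter] at ha
  have := pow_modEq p e _ _ _ (not_dvd_mod p (N + 1) c a hc ha.2 (Nat.succ_ne_zero N)) h'
  rw [← ZMod.natCast_eq_natCast_iff] at this
  push_cast at this
  rw [this]

lemma totient_dvd (p : ℕ) [hp : Fact p.Prime] {d e : ℕ} (h : d ≤ e) :
    Nat.totient (p ^ d) ∣ Nat.totient (p ^ e) := Nat.totient_dvd_of_dvd (pow_dvd_pow p h)

open Filter Topology in
lemma tendsto_pneg (p : ℕ) [hp : Fact p.Prime] :
    Tendsto (fun e : ℕ => (p : ℝ) ^ (-(e : ℤ))) atTop (𝓝 0) := by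
  have := (tendsto_p p).norm
  simpa using this

open Filter Topology in
lemma exists_limit (p : ℕ) [hp : Fact p.Prime] (f : ℕ → ℚ_[p]) (n : ℕ)
    (hf : ∀ (e m m' : ℕ), 0 < m → 0 < m' → m ≡ m' [MOD Nat.totient (p ^ e)] →
      ‖f m - f m'‖ ≤ (p : ℝ) ^ (-(e : ℤ))) :
    ∃ L : ℚ_[p], ∀ e m : ℕ, 0 < m → Nat.totient (p ^ e) ∣ m + n →
      ‖f m - L‖ ≤ (p : ℝ) ^ (-(e : ℤ)) := by
  let s : ℕ → ℕ := fun e => (n + 1) * Nat.totient (p ^ e) - n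
  have ht : ∀ e, 0 < Nat.totient (p ^ e) := fun e => Nat.totient_pos.2 (pow_pos hp.out.pos _)
  have hs : ∀ e, 0 < s e ∧ Nat.totient (p ^ e) ∣ s e + n := by
    intro e
    have h1 : n + 1 ≤ (n + 1) * Nat.totient (p ^ e) := Nat.le_mul_of_pos_right _ (ht e)
    refine ⟨by simp only [s]; omega, ?_⟩
    have : s e + n = (n + 1) * Nat.totient (p ^ e) := by simp only [s]; omega
    rw [this]
    exact dvd_mul_left _ _
  have hmod : ∀ e a b, Nat.totient (p ^ e) ∣ a + n → Nat.totient (p ^ e) ∣ b + n →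
      a ≡ b [MOD Nat.totient (p ^ e)] := by
    intro e a b ha hb
    apply Nat.ModEq.add_right_cancel' n
    exact ((Nat.modEq_zero_iff_dvd).2 ha).trans ((Nat.modEq_zero_iff_dvd).2 hb).symm
  have hcau : CauchySeq (fun e => f (s e)) := by
    refine cauchySeq_of_le_tendsto_0' (fun e : ℕ => (p : ℝ) ^ (-(e : ℤ))) (fun a b hab => ?_)
      (tendsto_pneg p)
    rw [dist_eq_norm]
    exact hf a _ _ (hs a).1 (hs b).1 (hmod a _ _ (hs a).2 ((totient_dvd p hab).trans (hs b).2))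
  obtain ⟨L, hL⟩ := cauchySeq_tendsto_of_complete hcau
  refine ⟨L, fun e m hm hd => ?_⟩
  refine le_of_tendsto (tendsto_const_nhds.sub hL).norm ?_
  filter_upwards [eventually_ge_atTop e] with b hb
  exact hf e _ _ hm (hs b).1 (hmod e _ _ hd ((totient_dvd p hb).trans (hs b).2))

theorem stmt_2 (p : ℕ) [Fact p.Prime] (n : ℕ) (hn : 0 < n) :
    ∃ η : ℚ_[p], ∀ k : ℕ → ℕ,
      (∀ j, 0 < k j) →
      Filter.Tendsto (fun j => (k j : ℝ)) Filter.atTop Filter.atTop →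
      Filter.Tendsto (fun j => ‖(k j : ℚ_[p]) + (n : ℚ_[p])‖) Filter.atTop (nhds 0) →
      (∀ j, (2 * (k j : ℤ)) ≡ (-(2 * (n : ℤ))) [ZMOD ((p : ℤ) - 1)]) →
      Filter.Tendsto
        (fun j => ((-((1 - (p : ℚ) ^ (2 * k j - 1)) * bernoulli (2 * k j) / (2 * k j)) : ℚ) : ℚ_[p]))
        Filter.atTop (nhds η) := by
  have hp : p.Prime := Fact.out
  have hc : ¬ p ∣ p + 1 := by
    intro h
    have := (Nat.dvd_add_right (dvd_refl p)).1 h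
    exact hp.one_lt.ne' (Nat.dvd_one.1 this)
  obtain ⟨L, hL⟩ := exists_limit p (regVal p (p + 1)) (2 * n)
    (fun e m m' hm hm' h => kummer p (p + 1) hc e m m' hm hm' h)
  obtain ⟨C, hC⟩ := exists_limit p (fun m => ((p + 1 : ℕ) : ℚ_[p]) ^ m) (2 * n)
    (fun e m m' _ _ h => by
      have := norm_sub_le_of_modEq p e _ _ (pow_modEq p e (p + 1) m m' hc h)
      simpa only [Nat.cast_pow] using this)
  refine ⟨-(L / (C - 1)), fun k hk _ hk2 hk3 => ?_⟩
  have hc0 : ((p + 1 : ℕ) : ℚ_[p]) ≠ 0 := by exact_mod_cast Nat.succ_ne_zero p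
  have hpow1 : ∀ m : ℕ, m ≠ 0 → ((p + 1 : ℕ) : ℚ_[p]) ^ m ≠ 1 := by
    intro m hm h
    have h' : (p + 1) ^ m = 1 := by exact_mod_cast h
    have := Nat.one_lt_pow hm (show 1 < p + 1 by have := hp.pos; omega)
    omega
  have hev : ∀ e : ℕ, ∀ᶠ j in Filter.atTop, Nat.totient (p ^ e) ∣ 2 * k j + 2 * n := by
    intro e
    have hpe : (0 : ℝ) < (p : ℝ) ^ (-(e : ℤ)) := by
      have : (0 : ℝ) < p := by exact_mod_cast hp.pos
      positivity
    filter_upwards [hk2.eventually (gt_mem_nhds hpe)] with j hj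
    have h1 : p ^ e ∣ k j + n := by
      have := (Padic.norm_int_le_pow_iff_dvd (p := p) ((k j + n : ℕ) : ℤ) e).1
        (by push_cast; exact hj.le)
      exact_mod_cast this
    have h2 : (p - 1) ∣ 2 * k j + 2 * n := by
      have := (hk3 j).symm.dvd
      have h3 : ((p - 1 : ℕ) : ℤ) ∣ ((2 * k j + 2 * n : ℕ) : ℤ) := by
        rw [Nat.cast_sub hp.one_le]
        push_cast
        simpa [sub_neg_eq_add] using this
      exact_mod_cast h3
    rcases e with _ | e
    · simp
    · rw [Nat.totient_prime_pow_succ hp]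
      refine Nat.Coprime.mul_dvd_of_dvd_of_dvd ?_ ?_ h2
      · apply Nat.Coprime.pow_left
        have := (Nat.coprime_self_sub_right hp.one_le).2 (Nat.coprime_one_right p)
        exact this
      · rw [← mul_add]
        exact Dvd.dvd.mul_left ((pow_dvd_pow p e.le_succ).trans h1) 2
  have gen : ∀ (f : ℕ → ℚ_[p]) (L : ℚ_[p]), (∀ e m : ℕ, 0 < m → Nat.totient (p ^ e) ∣ m + 2 * n →
      ‖f m - L‖ ≤ (p : ℝ) ^ (-(e : ℤ))) →
      Filter.Tendsto (fun j => f (2 * k j)) Filter.atTop (nhds L) := by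
    intro f L hfL
    rw [Metric.tendsto_nhds]
    intro ε hε
    obtain ⟨e, he⟩ := ((tendsto_pneg p).eventually (gt_mem_nhds hε)).exists
    filter_upwards [hev e] with j hj
    rw [dist_eq_norm]
    exact (hfL e _ (by have := hk j; omega) hj).trans_lt he
  have tL := gen _ L hL
  have tC := gen _ C hC
  have tC' : Filter.Tendsto (fun j => ((p + 1 : ℕ) : ℚ_[p]) ^ (2 * k j) * ((p + 1 : ℕ) : ℚ_[p]) ^ (2 * n))
      Filter.atTop (nhds 1) := by
    refine gen (fun m => ((p + 1 : ℕ) : ℚ_[p]) ^ m * ((p + 1 : ℕ) : ℚ_[p]) ^ (2 * n)) 1 ?_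
    intro e m _ hd
    have := norm_sub_le_of_modEq p e _ _ (pow_modEq p e (p + 1) (m + 2 * n) 0 hc
      ((Nat.modEq_zero_iff_dvd).2 hd))
    simpa only [Nat.cast_pow, pow_add, pow_zero, Nat.cast_one, Nat.cast_mul] using this
  have hCn : C * ((p + 1 : ℕ) : ℚ_[p]) ^ (2 * n) = 1 :=
    tendsto_nhds_unique (tC.mul_const _) tC'
  have hC1 : C - 1 ≠ 0 := by
    intro h
    rw [sub_eq_zero.1 h, one_mul] at hCn
    exact hpow1 _ (by omega) hCn
  have := (tL.div (tC.sub_const 1) hC1).neg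
  refine this.congr fun j => ?_
  have h1 : ((p + 1 : ℕ) : ℚ_[p]) ^ (2 * k j) - 1 ≠ 0 :=
    sub_ne_zero.2 (hpow1 _ (by have := hk j; omega))
  have hk0 : (k j : ℚ_[p]) ≠ 0 := by exact_mod_cast (hk j).ne'
  simp only [regVal, Pi.div_apply]
  generalize ((p + 1 : ℕ) : ℚ_[p]) ^ (2 * k j) = X at h1
  push_cast
  field_simp
end

section
/- Let η ∈ ℚ₂ and suppose there exists a sequence (k_j)_{j≥0} of positive integers with k_j → ∞ (in ℝ) and ‖k_j + 1‖₂ → 0 such that the rational numbers −(1 − 2^{2k_j − 1})·B_{2k_j}/(2k_j), viewed in ℚ₂, converge to η (i.e. η = ζ₂(3)). Then η is not in the image of the canonical embedding ℚ → ℚ₂. -/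
lemma prime_dvd_choose_of_carry {p a b : ℕ} (hp : p.Prime) (h : p ≤ a % p + b % p) :
    p ∣ (a + b).choose a := by
  have hpos : 0 < (a + b).choose a := Nat.choose_pos (by omega)
  have h1 : 1 ≤ ((a + b).choose a).factorization p := by
    have h2 : Nat.log p (a + b) < (Nat.log p (a + b) + 2) := by omega
    have h3 := Nat.factorization_choose' hp (n := b) (k := a) (b := Nat.log p (a + b) + 2) (by rw [add_comm b a]; exact h2)
    rw [add_comm b a] at h3
    rw [h3]
    apply Finset.card_pos.mpr
    refine ⟨1, ?_⟩
    simp only [Finset.mem_filter, Finset.mem_Ico, pow_one]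
    omega
  exact (hp.dvd_iff_one_le_factorization hpos.ne').mpr h1

lemma prime_dvd_A {p m : ℕ} (hp : p.Prime) (h1 : m < p) (h2 : p ≤ 6 * m) :
    p ∣ (6 * m).choose (3 * m) * (3 * m).choose m := by
  have key1 : p ≤ (3*m) % p + (3*m) % p → p ∣ (6 * m).choose (3 * m) := by
    intro h
    have := prime_dvd_choose_of_carry hp h
    rwa [show 3 * m + 3 * m = 6 * m by ring] at this
  have key2 : p ≤ m % p + (2*m) % p → p ∣ (3 * m).choose m := by
    intro h
    have := prime_dvd_choose_of_carry hp h
    rwa [show m + 2 * m = 3 * m by ring] at this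
  have hm : m % p = m := Nat.mod_eq_of_lt h1
  by_cases c1 : 3 * m < p
  · apply Dvd.dvd.mul_right; apply key1
    rw [Nat.mod_eq_of_lt c1]; omega
  by_cases c2 : 2 * m < p
  · apply Dvd.dvd.mul_left; apply key2
    rw [Nat.mod_eq_of_lt c2, hm]; omega
  by_cases c3 : 3 * m < 2 * p
  · apply Dvd.dvd.mul_right; apply key1
    have : (3 * m) % p = 3 * m - p := by
      rw [Nat.mod_eq_sub_mod (by omega), Nat.mod_eq_of_lt (by omega)]
    omega
  · apply Dvd.dvd.mul_left; apply key2
    have : (2 * m) % p = 2 * m - p := by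
      rw [Nat.mod_eq_sub_mod (by omega), Nat.mod_eq_of_lt (by omega)]
    omega

lemma A_le (m : ℕ) : (6 * m).choose (3 * m) * (3 * m).choose m ≤ 432 ^ m := by
  have h1 : (6 * m).choose (3 * m) ≤ 64 ^ m := by
    have := Nat.choose_le_two_pow (6*m) (3*m)
    rwa [pow_mul] at this
  have h2 : (3 * m).choose m * 4 ^ m ≤ 27 ^ m := by
    have h := add_pow (1:ℕ) 2 (3 * m)
    have h3 : 1 ^ m * 2 ^ (3 * m - m) * (3 * m).choose m ≤ (1 + 2) ^ (3 * m) := by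
      rw [h]
      exact Finset.single_le_sum (f := fun i => 1 ^ i * 2 ^ (3 * m - i) * (3 * m).choose i)
        (fun _ _ => Nat.zero_le _) (Finset.mem_range.mpr (by omega))
    rw [show 3 * m - m = 2 * m by omega, pow_mul, pow_mul] at h3
    norm_num at h3
    linarith
  have h4 : 0 < 4 ^ m := by positivity
  apply Nat.le_of_mul_le_mul_right _ h4
  calc _ = (6 * m).choose (3 * m) * ((3 * m).choose m * 4 ^ m) := by ring
    _ ≤ 64 ^ m * 27 ^ m := Nat.mul_le_mul h1 h2
    _ = 432 ^ m * 4 ^ m := by rw [← mul_pow, ← mul_pow]; norm_num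

lemma primorial_six (m : ℕ) : primorial (6 * m) ≤ primorial m * 432 ^ m := by
  refine le_trans ?_ (Nat.mul_le_mul_left _ (A_le m))
  have h := primorial_add m (5 * m)
  rw [show m + 5 * m = 6 * m by ring] at h
  rw [h]
  refine Nat.mul_le_mul_left _ (Nat.le_of_dvd ?_ ?_)
  · exact Nat.mul_pos (Nat.choose_pos (by omega)) (Nat.choose_pos (by omega))
  · refine Finset.prod_primes_dvd _ (fun p hp => ?_) (fun p hp => ?_)
    · exact (Finset.mem_filter.mp hp).2.prime
    · have := Finset.mem_filter.mp hp
      have h2 := Finset.mem_Ico.mp this.1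
      exact prime_dvd_A this.2 (by omega) (by omega)

lemma log_primorial_le (n : ℕ) : Real.log (primorial n) ≤ 1.3 * n + 300 := by
  induction n using Nat.strong_induction_on with
  | _ n ih =>
    have l2 := Real.log_two_lt_d9
    by_cases hn : n < 200
    · have h1 : Real.log (primorial n) ≤ Real.log ((4:ℝ) ^ n) := by
        apply Real.log_le_log
        · exact_mod_cast primorial_pos n
        · exact_mod_cast primorial_le_four_pow n
      rw [Real.log_pow, show (4:ℝ) = 2 ^ 2 by norm_num, Real.log_pow] at h1
      have h2 : (n:ℝ) < 200 := by exact_mod_cast hn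
      have h3 : (0:ℝ) ≤ n := by positivity
      push_cast at h1
      nlinarith
    · set m := (n + 5) / 6 with hm
      have hm1 : n ≤ 6 * m := by omega
      have hm2 : 6 * m ≤ n + 5 := by omega
      have h := ih m (by omega)
      have h1 : Real.log (primorial n) ≤ Real.log (primorial m * 2 ^ (9 * m)) := by
        apply Real.log_le_log
        · exact_mod_cast primorial_pos n
        · have : primorial n ≤ primorial m * 2 ^ (9 * m) := by
            refine (primorial_mono hm1).trans ((primorial_six m).trans ?_)
            rw [pow_mul]
            gcongr
            norm_num
          exact_mod_cast this
      rw [Real.log_mul (by exact_mod_cast (primorial_pos m).ne') (by positivity), Real.log_pow] at h1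
      have h3 : (6:ℝ) * m ≤ n + 5 := by exact_mod_cast hm2
      have h4 : (200:ℝ) ≤ n := by exact_mod_cast not_lt.mp hn
      push_cast at h1
      nlinarith

/-- `d_n^3 * C * (n+1)^e = o(64^n)`. -/
lemma log_lcm_le (n : ℕ) (hn : 1 ≤ n) :
    Real.log (Nat.lcmUpto n) ≤ 1.3 * n + 300 + 2 * √n * Real.log n := by
  rw [← Chebyshev.psi_eq_log_lcmUpto]
  have h1 := Chebyshev.psi_sub_theta_le (x := n) (by exact_mod_cast hn)
  have h2 := log_primorial_le n
  have h3 := Chebyshev.theta_eq_log_primorial n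
  simp only [Nat.floor_natCast] at h3
  linarith

open Filter Asymptotics in
lemma eventually_small (C : ℝ) (hC : 0 < C) : ∀ᶠ n : ℕ in atTop,
    C * ((n:ℝ) + 1) ^ 10 * (Nat.lcmUpto n : ℝ) ^ 3 < 64 ^ n := by
  have e1 : (fun x : ℝ => √x * Real.log x) =o[atTop] (fun x => x) := by
    have := isLittleO_log_rpow_atTop (r := 1/2) (by norm_num)
    have h2 := (isBigO_refl (fun x : ℝ => √x) atTop).mul_isLittleO this
    refine h2.congr' (by rfl) ?_
    filter_upwards [eventually_ge_atTop 0] with x hx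
    rw [← Real.sqrt_eq_rpow, Real.mul_self_sqrt hx]
  have e2 : (fun x : ℝ => Real.log x) =o[atTop] (fun x => x) := Real.isLittleO_log_id_atTop
  have b1 := (e1.bound (show (0:ℝ) < 0.01 by norm_num))
  have b2 := (e2.bound (show (0:ℝ) < 0.001 by norm_num))
  have c1 := tendsto_natCast_atTop_atTop (R := ℝ) |>.eventually b1
  have c2 := tendsto_natCast_atTop_atTop (R := ℝ) |>.eventually b2
  have c3 := tendsto_natCast_atTop_atTop (R := ℝ) |>.eventually
    (eventually_ge_atTop (100 * (900 + |Real.log C| + 10)))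
  filter_upwards [c1, c2, c3, eventually_ge_atTop 1] with n h1 h2 h3 h4
  have hn1 : (1:ℝ) ≤ n := by exact_mod_cast h4
  have hl : 0 ≤ Real.log n := Real.log_nonneg hn1
  rw [Real.norm_of_nonneg (by positivity), Real.norm_of_nonneg (by positivity)] at h1
  rw [Real.norm_of_nonneg (by positivity), Real.norm_of_nonneg (by positivity)] at h2
  have hd : (0:ℝ) < Nat.lcmUpto n := by exact_mod_cast Nat.lcmUpto_pos n
  have hlog := log_lcm_le n h4
  rw [← Real.log_lt_log_iff (by positivity) (by positivity),
    Real.log_mul (by positivity) (by positivity), Real.log_mul (by positivity) (by positivity),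
    Real.log_pow, Real.log_pow, Real.log_pow, show (64:ℝ) = 2 ^ 6 by norm_num, Real.log_pow]
  have hn2 : Real.log ((n:ℝ) + 1) ≤ Real.log n + 1 := by
    have : Real.log ((n:ℝ) + 1) ≤ Real.log (n * 2) := by
      apply Real.log_le_log (by positivity); linarith
    rw [Real.log_mul (by positivity) (by norm_num)] at this
    linarith [Real.log_two_lt_d9]
  have := le_abs_self (Real.log C)
  have l2 := Real.log_two_gt_d9
  push_cast
  nlinarith

lemma n2 : ‖(2 : ℚ_[2])‖ = 2⁻¹ := by
  have := Padic.norm_p (p := 2); simpa using this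

lemma n4 : ‖(4 : ℚ_[2])‖ = 4⁻¹ := by
  rw [show (4 : ℚ_[2]) = 2 * 2 by norm_num, norm_mul, n2]; norm_num

lemma nsub_le {a b : ℚ_[2]} {c : ℝ} (ha : ‖a‖ ≤ c) (hb : ‖b‖ ≤ c) : ‖a - b‖ ≤ c := by
  rw [sub_eq_add_neg]
  refine (Padic.nonarchimedean _ _).trans (max_le ha (by rwa [norm_neg]))

lemma nadd_le {a b : ℚ_[2]} {c : ℝ} (ha : ‖a‖ ≤ c) (hb : ‖b‖ ≤ c) : ‖a + b‖ ≤ c :=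
  (Padic.nonarchimedean _ _).trans (max_le ha hb)

lemma nsum_le {ι : Type*} (s : Finset ι) (f : ι → ℚ_[2]) {c : ℝ} (hc : 0 ≤ c)
    (h : ∀ i ∈ s, ‖f i‖ ≤ c) : ‖∑ i ∈ s, f i‖ ≤ c :=
  IsUltrametricDist.norm_sum_le_of_forall_le_of_nonneg hc h

lemma nunit (z : ℤ) : ‖(4 * z + 1 : ℚ_[2])‖ = 1 := by
  have : ‖((4 * z + 1 : ℤ) : ℚ_[2])‖ = 1 := by
    rw [Padic.norm_intCast_eq_one_iff, Int.isCoprime_iff_gcd_eq_one]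
    have : (2:ℤ).gcd (4 * z + 1) = 1 := by
      rw [← Int.isCoprime_iff_gcd_eq_one]
      exact ⟨-2 * z, 1, by ring⟩
    rw [Int.gcd_comm]; exact_mod_cast this
  push_cast at this; exact this

lemma nunit_nat (t : ℕ) : ‖(4 * t + 1 : ℚ_[2])‖ = 1 := by
  have := nunit t; push_cast at this; exact this

/-- Riemann-type averages computing the Volkenborn integral. -/
noncomputable def vol (N : ℕ) (h : ℕ → ℚ_[2]) : ℚ_[2] :=
  ((2 : ℚ_[2]) ^ N)⁻¹ * ∑ t ∈ Finset.range (2 ^ N), h t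

lemma norm_two_pow_inv (N : ℕ) : ‖((2 : ℚ_[2]) ^ N)⁻¹‖ = 2 ^ N := by
  rw [norm_inv, norm_pow, n2, inv_pow, inv_inv]

lemma norm_two_pow (N : ℕ) : ‖(2 : ℚ_[2]) ^ N‖ = (2 ^ N)⁻¹ := by
  rw [norm_pow, n2, inv_pow]

lemma vol_succ (N : ℕ) (h : ℕ → ℚ_[2]) : vol (N + 1) h - vol N h =
    ((2 : ℚ_[2]) ^ (N + 1))⁻¹ * ∑ t ∈ Finset.range (2 ^ N), (h (t + 2 ^ N) - h t) := by
  have h2 : (2 : ℚ_[2]) ^ N ≠ 0 := pow_ne_zero _ two_ne_zero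
  unfold vol
  rw [show 2 ^ (N + 1) = 2 ^ N + 2 ^ N by ring, Finset.sum_range_add, Finset.sum_sub_distrib]
  simp only [add_comm (2 ^ N) _]
  rw [pow_succ]
  field_simp
  ring

lemma vol_bound (h : ℕ → ℚ_[2]) (N0 : ℕ) (c : ℝ) (hc : 0 ≤ c)
    (hh : ∀ N, N0 ≤ N → ∀ t, ‖h (t + 2 ^ N) - h t‖ ≤ c * (2 ^ (N + 1))⁻¹) :
    ∀ N, N0 ≤ N → ‖vol N h - vol N0 h‖ ≤ c := by
  intro N hN
  induction N, hN using Nat.le_induction with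
  | base => simpa using hc
  | succ N hN ih =>
    have e : vol (N + 1) h - vol N0 h = (vol (N + 1) h - vol N h) + (vol N h - vol N0 h) := by ring
    rw [e]
    refine nadd_le ?_ ih
    rw [vol_succ, norm_mul, norm_two_pow_inv]
    have := nsum_le (Finset.range (2 ^ N)) (fun t => h (t + 2 ^ N) - h t)
      (c := c * (2 ^ (N + 1))⁻¹) (by positivity) (fun t _ => hh N hN t)
    calc _ ≤ 2 ^ (N + 1) * (c * (2 ^ (N + 1))⁻¹) := by gcongr
      _ = c := by field_simp

lemma npow_sub_one (w : ℕ) : ∀ x : ℚ_[2], ‖x - 1‖ ≤ 2⁻¹ → ‖x ^ w - 1‖ ≤ ‖(w : ℚ_[2])‖ * ‖x - 1‖ := by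
  induction w using Nat.strong_induction_on with
  | _ w ih =>
    intro x hx
    have hx1 : ‖x‖ ≤ 1 := by
      have : x = (x - 1) + 1 := by ring
      rw [this]; exact nadd_le (hx.trans (by norm_num)) (by simp)
    rcases Nat.even_or_odd w with ⟨u, hu⟩ | hodd
    · rcases Nat.eq_zero_or_pos w with h0 | hpos
      · subst h0; simp
      · have hx2 : ‖x ^ 2 - 1‖ ≤ 2⁻¹ * ‖x - 1‖ := by
          rw [show x ^ 2 - 1 = (2 + (x - 1)) * (x - 1) by ring, norm_mul]
          gcongr
          exact nadd_le n2.le hx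
        have := ih u (by omega) (x ^ 2) (hx2.trans (by nlinarith [norm_nonneg (x - 1)]))
        rw [← pow_mul, show 2 * u = w by omega] at this
        refine this.trans ?_
        have hw : (w : ℚ_[2]) = 2 * u := by rw [hu]; push_cast; ring
        rw [hw, norm_mul, n2]
        calc _ ≤ ‖(u : ℚ_[2])‖ * (2⁻¹ * ‖x - 1‖) := by gcongr
          _ = _ := by ring
    · have hw : ‖(w : ℚ_[2])‖ = 1 := by
        rw [Padic.norm_natCast_eq_one_iff]
        exact (Nat.coprime_two_left.mpr hodd)
      rw [hw, one_mul, ← mul_geom_sum, norm_mul]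
      refine mul_le_of_le_one_right (norm_nonneg _) ?_
      refine nsum_le _ _ zero_le_one (fun i _ => ?_)
      rw [norm_pow]
      exact pow_le_one₀ (norm_nonneg _) hx1

lemma npow_sub_pow (w : ℕ) (a b : ℚ_[2]) (ha : ‖a‖ = 1) (hab : ‖b - a‖ ≤ 2⁻¹) :
    ‖b ^ w - a ^ w‖ ≤ ‖(w : ℚ_[2])‖ * ‖b - a‖ := by
  have ha0 : a ≠ 0 := by intro h; simp [h] at ha
  have h1 : ‖b / a - 1‖ = ‖b - a‖ := by
    rw [show b / a - 1 = (b - a) / a by field_simp, norm_div, ha, div_one]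
  have := npow_sub_one w (b / a) (by rw [h1]; exact hab)
  rw [h1] at this
  have e : b ^ w - a ^ w = a ^ w * ((b / a) ^ w - 1) := by
    rw [div_pow]; field_simp
  rw [e, norm_mul, norm_pow, ha, one_pow, one_mul]
  exact this

lemma ninv_sub (a b : ℚ_[2]) (ha : ‖a‖ = 1) (hb : ‖b‖ = 1) : ‖b⁻¹ - a⁻¹‖ = ‖b - a‖ := by
  have ha0 : a ≠ 0 := by intro h; simp [h] at ha
  have hb0 : b ≠ 0 := by intro h; simp [h] at hb
  rw [show b⁻¹ - a⁻¹ = - ((b - a) / (a * b)) by field_simp; ring, norm_neg, norm_div, norm_mul, ha, hb]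
  simp

lemma nshift (t N : ℕ) : ‖((4 * (t + 2 ^ N : ℕ) + 1 : ℚ_[2])) - (4 * t + 1)‖ = (2 ^ (N + 2))⁻¹ := by
  rw [show ((4 * (t + 2 ^ N : ℕ) + 1 : ℚ_[2])) - (4 * t + 1) = 2 ^ (N + 2) by push_cast; ring,
    norm_two_pow]

lemma two_pow_inv_le (N : ℕ) : ((2:ℝ) ^ (N + 2))⁻¹ ≤ 2⁻¹ := by
  rw [inv_le_inv₀ (by positivity) (by norm_num)]
  calc (2:ℝ) = 2 ^ 1 := by norm_num
    _ ≤ 2 ^ (N + 2) := pow_le_pow_right₀ (by norm_num) (by omega)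

lemma two_pow_inv_succ (N : ℕ) : ((2:ℝ) ^ (N + 2))⁻¹ ≤ (2 ^ (N + 1))⁻¹ := by
  rw [inv_le_inv₀ (by positivity) (by positivity)]
  exact pow_le_pow_right₀ (by norm_num) (by omega)

/-- The approximations to `4 ζ₂(3)`. -/
noncomputable def TT (N : ℕ) : ℚ_[2] := vol N (fun t => ((4 * t + 1 : ℚ_[2]) ^ 2)⁻¹)

lemma vol_pow_sub_TT (k N : ℕ) :
    ‖vol N (fun t => (4 * t + 1 : ℚ_[2]) ^ (2 * k)) - TT N‖ ≤ ‖((2 * k + 2 : ℕ) : ℚ_[2])‖ := by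
  set w := 2 * k + 2 with hw
  have key := vol_bound (fun t => (4 * t + 1 : ℚ_[2]) ^ (2 * k) - ((4 * t + 1 : ℚ_[2]) ^ 2)⁻¹) 0
    ‖(w : ℚ_[2])‖ (norm_nonneg _) ?_ N (Nat.zero_le _)
  · have e : vol N (fun t => (4 * t + 1 : ℚ_[2]) ^ (2 * k)) - TT N =
      vol N (fun t => (4 * t + 1 : ℚ_[2]) ^ (2 * k) - ((4 * t + 1 : ℚ_[2]) ^ 2)⁻¹) := by
      unfold TT vol
      rw [Finset.sum_sub_distrib]; ring
    rw [e]
    have e0 : vol 0 (fun t => (4 * t + 1 : ℚ_[2]) ^ (2 * k) - ((4 * t + 1 : ℚ_[2]) ^ 2)⁻¹) = 0 := by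
      simp [vol]
    rwa [e0, sub_zero] at key
  · intro N _ t
    have hs := nshift t N
    have ha := nunit_nat t
    have hb := nunit_nat (t + 2 ^ N)
    have ha4 : ‖(4 * t + 1 : ℚ_[2]) - 1‖ ≤ 2⁻¹ := by
      rw [add_sub_cancel_right, norm_mul, n4]
      have := Padic.norm_int_le_one (p := 2) t
      rw [Int.cast_natCast] at this
      linarith
    set a : ℚ_[2] := 4 * t + 1 with hadef
    set b : ℚ_[2] := 4 * (t + 2 ^ N : ℕ) + 1 with hbdef
    have ha0 : a ≠ 0 := by intro h; simp [h] at ha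
    have hb0 : b ≠ 0 := by intro h; simp [h] at hb
    have e : b ^ (2 * k) - (b ^ 2)⁻¹ - (a ^ (2 * k) - (a ^ 2)⁻¹) =
        (b ^ 2)⁻¹ * (b ^ w - a ^ w) + ((b ^ 2)⁻¹ - (a ^ 2)⁻¹) * (a ^ w - 1) := by
      rw [hw, pow_add, pow_add]
      field_simp
      ring
    show ‖b ^ (2 * k) - (b ^ 2)⁻¹ - (a ^ (2 * k) - (a ^ 2)⁻¹)‖ ≤ _
    rw [e]
    have h1 := npow_sub_pow w a b ha (by rw [hs]; exact two_pow_inv_le N)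
    have h2 := npow_sub_one w a ha4
    have h3 : ‖(b ^ 2)⁻¹ - (a ^ 2)⁻¹‖ ≤ (2 ^ (N + 2))⁻¹ := by
      rw [ninv_sub _ _ (by rw [norm_pow, ha, one_pow]) (by rw [norm_pow, hb, one_pow])]
      refine (npow_sub_pow 2 a b ha (by rw [hs]; exact two_pow_inv_le N)).trans ?_
      rw [hs]
      refine mul_le_of_le_one_left (by positivity) ?_
      rw [Nat.cast_ofNat, n2]; norm_num
    have hw0 := norm_nonneg (w : ℚ_[2])
    refine le_trans ?_ (mul_le_mul_of_nonneg_left (two_pow_inv_succ N) hw0)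
    refine nadd_le ?_ ?_
    · rw [norm_mul, norm_inv, norm_pow, hb, one_pow, inv_one, one_mul]
      rw [hs] at h1
      exact h1
    · rw [norm_mul, mul_comm]
      refine mul_le_mul ?_ h3 (norm_nonneg _) hw0
      refine h2.trans (mul_le_of_le_one_right hw0 (ha4.trans (by norm_num)))

open Filter Topology

lemma tendsto_two_pow : Tendsto (fun N : ℕ => (2 : ℚ_[2]) ^ N) atTop (𝓝 0) :=
  tendsto_pow_atTop_nhds_zero_of_norm_lt_one (by rw [n2]; norm_num)

lemma tendsto_faulhaber (m : ℕ) :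
    Tendsto (fun N => vol N (fun y => (y : ℚ_[2]) ^ m)) atTop (𝓝 (bernoulli m : ℚ)) := by
  have e : ∀ N, vol N (fun y => (y : ℚ_[2]) ^ m) = ∑ i ∈ Finset.range (m + 1),
      ((bernoulli i * ((m + 1).choose i) / (m + 1) : ℚ) : ℚ_[2]) * ((2:ℚ_[2]) ^ N) ^ (m - i) := by
    intro N
    have h := congrArg (fun q : ℚ => (q : ℚ_[2])) (sum_range_pow (2 ^ N) m)
    simp only [Rat.cast_sum, Rat.cast_pow, Rat.cast_natCast] at h
    unfold vol
    rw [h, Finset.mul_sum]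
    refine Finset.sum_congr rfl (fun i hi => ?_)
    have hi' : i ≤ m := by simpa [Nat.lt_succ_iff] using hi
    rw [show m + 1 - i = (m - i) + 1 by omega, pow_succ]
    have h2 : (2 : ℚ_[2]) ^ N ≠ 0 := pow_ne_zero _ two_ne_zero
    push_cast
    field_simp
  simp_rw [e]
  have : ((bernoulli m : ℚ) : ℚ_[2]) = ∑ i ∈ Finset.range (m + 1),
      ((bernoulli i * ((m + 1).choose i) / (m + 1) : ℚ) : ℚ_[2]) * (0:ℚ_[2]) ^ (m - i) := by
    rw [Finset.sum_range_succ, Finset.sum_eq_zero]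
    · have : ((m:ℚ_[2]) + 1) ≠ 0 := by exact_mod_cast Nat.succ_ne_zero m
      simp; field_simp
    · intro i hi
      have : i < m := by simpa using hi
      rw [zero_pow (by omega), mul_zero]
  rw [this]
  refine tendsto_finsetSum _ (fun i _ => ?_)
  exact (tendsto_two_pow.pow _).const_mul _

lemma norm_sum_pow (m N : ℕ) :
    ‖∑ t ∈ Finset.range (2 ^ N), (4 * t + 1 : ℚ_[2]) ^ m‖ ≤ (2 ^ N)⁻¹ := by
  have key := vol_bound (fun t => (4 * t + 1 : ℚ_[2]) ^ m) 0 1 zero_le_one ?_ N (Nat.zero_le _)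
  · have h1 : ‖vol N (fun t => (4 * t + 1 : ℚ_[2]) ^ m)‖ ≤ 1 := by
      have e0 : vol 0 (fun t => (4 * t + 1 : ℚ_[2]) ^ m) = 1 := by simp [vol]
      have := nadd_le key (show ‖vol 0 (fun t => (4 * t + 1 : ℚ_[2]) ^ m)‖ ≤ 1 by rw [e0]; simp)
      rwa [sub_add_cancel] at this
    unfold vol at h1
    rw [norm_mul, norm_two_pow_inv] at h1
    rw [inv_eq_one_div, le_div_iff₀ (by positivity), mul_comm]
    exact h1
  · intro N _ t
    refine (npow_sub_pow m _ _ (nunit_nat t) (by rw [nshift]; exact two_pow_inv_le N)).trans ?_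
    rw [nshift]
    refine mul_le_mul ?_ (two_pow_inv_succ N) (by positivity) zero_le_one
    exact_mod_cast Padic.norm_int_le_one (p := 2) m

lemma sum_reflect (m N : ℕ) : ∑ t ∈ Finset.range (2 ^ N), (4 * t + 3 : ℚ_[2]) ^ m =
    ∑ t ∈ Finset.range (2 ^ N), ((2:ℚ_[2]) ^ (N + 2) - (4 * t + 1)) ^ m := by
  rw [← Finset.sum_range_reflect]
  refine Finset.sum_congr rfl (fun t ht => ?_)
  have : t < 2 ^ N := by simpa using ht
  congr 1
  rw [Nat.sub_sub, Nat.cast_sub (by omega)]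
  push_cast
  ring

lemma sum_four (m N : ℕ) : ∑ y ∈ Finset.range (2 ^ (N + 2)), (y : ℚ_[2]) ^ m =
    2 ^ m * ∑ y ∈ Finset.range (2 ^ (N + 1)), (y : ℚ_[2]) ^ m +
    ∑ t ∈ Finset.range (2 ^ N), (4 * t + 1 : ℚ_[2]) ^ m +
    ∑ t ∈ Finset.range (2 ^ N), (4 * t + 3 : ℚ_[2]) ^ m := by
  have gen : ∀ M : ℕ, ∑ y ∈ Finset.range (M * 4), (y : ℚ_[2]) ^ m =
    2 ^ m * ∑ y ∈ Finset.range (M * 2), (y : ℚ_[2]) ^ m +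
    ∑ t ∈ Finset.range M, (4 * t + 1 : ℚ_[2]) ^ m +
    ∑ t ∈ Finset.range M, (4 * t + 3 : ℚ_[2]) ^ m := by
    intro M
    induction M with
    | zero => simp
    | succ M ih =>
      rw [show (M + 1) * 4 = M * 4 + 1 + 1 + 1 + 1 by ring, show (M + 1) * 2 = M * 2 + 1 + 1 by ring]
      simp only [Finset.sum_range_succ, ih, mul_add, ← mul_pow]
      push_cast
      rw [show (2:ℚ_[2]) * (M * 2) = M * 4 by ring, show (2:ℚ_[2]) * (M * 2 + 1) = M * 4 + 2 by ring,
        show (M:ℚ_[2]) * 4 + 3 = 4 * M + 3 by ring, show (M:ℚ_[2]) * 4 + 1 = 4 * M + 1 by ring]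
      ring
  have := gen (2 ^ N)
  rwa [show 2 ^ N * 4 = 2 ^ (N + 2) by ring, show 2 ^ N * 2 = 2 ^ (N + 1) by ring] at this

lemma reflect_diff (m N : ℕ) (hm : Even m) :
    ‖((2 : ℚ_[2]) ^ N)⁻¹ * (∑ t ∈ Finset.range (2 ^ N), (4 * t + 3 : ℚ_[2]) ^ m -
      ∑ t ∈ Finset.range (2 ^ N), (4 * t + 1 : ℚ_[2]) ^ m)‖ ≤ (2 ^ N)⁻¹ := by
  choose z hz using fun t : ℕ => (⟨(Polynomial.powAddExpansion (4 * t + 1 : ℤ) (-2 ^ (N + 2)) m).1,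
    (Polynomial.powAddExpansion (4 * t + 1 : ℤ) (-2 ^ (N + 2)) m).2⟩ :
    ∃ k : ℤ, ((4 * t + 1 : ℤ) + (-2 ^ (N + 2))) ^ m = (4 * t + 1) ^ m +
      m * (4 * t + 1) ^ (m - 1) * (-2 ^ (N + 2)) + k * (-2 ^ (N + 2)) ^ 2)
  have h2 : (2 : ℚ_[2]) ^ N ≠ 0 := pow_ne_zero _ two_ne_zero
  have e : ((2 : ℚ_[2]) ^ N)⁻¹ * (∑ t ∈ Finset.range (2 ^ N), (4 * t + 3 : ℚ_[2]) ^ m -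
      ∑ t ∈ Finset.range (2 ^ N), (4 * t + 1 : ℚ_[2]) ^ m) =
      2 ^ N * (16 * ∑ t ∈ Finset.range (2 ^ N), (z t : ℚ_[2])) -
      (4 * m) * ∑ t ∈ Finset.range (2 ^ N), (4 * t + 1 : ℚ_[2]) ^ (m - 1) := by
    rw [sum_reflect, ← Finset.sum_sub_distrib]
    have : ∀ t : ℕ, ((2:ℚ_[2]) ^ (N + 2) - (4 * t + 1)) ^ m - (4 * t + 1) ^ m =
        2 ^ N * (2 ^ N * 16 * z t - 4 * m * (4 * t + 1) ^ (m - 1)) := by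
      intro t
      have h := congrArg (fun q : ℤ => (q : ℚ_[2])) (hz t)
      push_cast at h
      rw [← hm.neg_pow, show -((2:ℚ_[2]) ^ (N + 2) - (4 * t + 1)) = 4 * t + 1 + -2 ^ (N + 2) by ring, h]
      ring
    simp_rw [this]
    rw [← Finset.mul_sum, Finset.sum_sub_distrib, ← Finset.mul_sum, ← Finset.mul_sum]
    field_simp
  rw [e]
  have hz_le : ∀ q : ℤ, ‖(q : ℚ_[2])‖ ≤ 1 := Padic.norm_int_le_one
  refine nsub_le ?_ ?_
  · rw [norm_mul, norm_two_pow]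
    refine mul_le_of_le_one_right (by positivity) ?_
    have := hz_le (16 * ∑ t ∈ Finset.range (2 ^ N), z t)
    push_cast at this; exact this
  · rw [norm_mul]
    have h1 := norm_sum_pow (m - 1) N
    have h2 := hz_le (4 * m)
    push_cast at h2
    calc _ ≤ 1 * ((2:ℝ) ^ N)⁻¹ := by gcongr
      _ = _ := one_mul _

lemma tendsto_vol_pow (m : ℕ) (hm : Even m) :
    Tendsto (fun N => vol N (fun t => (4 * t + 1 : ℚ_[2]) ^ m)) atTop
      (𝓝 ((2 - 2 ^ m) * (bernoulli m : ℚ))) := by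
  have hF := tendsto_faulhaber m
  have hF1 := (tendsto_add_atTop_iff_nat 1).mpr hF
  have hF2 := (tendsto_add_atTop_iff_nat 2).mpr hF
  have hd : Tendsto (fun N => ((2 : ℚ_[2]) ^ N)⁻¹ * (∑ t ∈ Finset.range (2 ^ N), (4 * t + 3 : ℚ_[2]) ^ m -
      ∑ t ∈ Finset.range (2 ^ N), (4 * t + 1 : ℚ_[2]) ^ m)) atTop (𝓝 0) := by
    refine squeeze_zero_norm (fun N => reflect_diff m N hm) ?_
    simp_rw [← inv_pow]
    exact tendsto_pow_atTop_nhds_zero_of_lt_one (by norm_num) (by norm_num)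
  have key := ((hF2.const_mul 2).sub (hF1.const_mul (2 ^ m))).sub (hd.const_mul (1 / 2))
  have e2 : (2 * ((bernoulli m : ℚ) : ℚ_[2]) - 2 ^ m * (bernoulli m : ℚ) - 1 / 2 * 0) =
    (2 - 2 ^ m) * (bernoulli m : ℚ) := by ring
  rw [e2] at key
  refine key.congr (fun N => ?_)
  unfold vol
  rw [sum_four, pow_add, pow_add]
  have h2 : (2 : ℚ_[2]) ^ N ≠ 0 := pow_ne_zero _ two_ne_zero
  field_simp
  ring

lemma tendsto_TT (η : ℚ_[2]) (k : ℕ → ℕ) (hk0 : ∀ j, 0 < k j)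
    (h1 : Tendsto (fun j => ‖(k j : ℚ_[2]) + 1‖) atTop (nhds 0))
    (h2 : Tendsto
        (fun j => ((-((1 - (2 : ℚ) ^ (2 * k j - 1)) * bernoulli (2 * k j) / (2 * k j)) : ℚ) : ℚ_[2]))
        atTop (nhds η)) : Tendsto TT atTop (𝓝 (4 * η)) := by
  have h1' : Tendsto (fun j => (k j : ℚ_[2]) + 1) atTop (𝓝 0) := tendsto_zero_iff_norm_tendsto_zero.mpr h1
  have h1'' : Tendsto (fun j => (k j : ℚ_[2])) atTop (𝓝 (-1)) := by
    have := h1'.sub_const 1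
    simpa using this
  have hG : Tendsto (fun j => (2 - 2 ^ (2 * k j)) * ((bernoulli (2 * k j) : ℚ) : ℚ_[2])) atTop
      (𝓝 (4 * η)) := by
    have := (h1''.const_mul (-4)).mul h2
    rw [show (-4 : ℚ_[2]) * -1 = 4 by norm_num] at this
    refine this.congr (fun j => ?_)
    have hk : (k j : ℚ_[2]) ≠ 0 := by exact_mod_cast (hk0 j).ne'
    have hp : (2:ℚ_[2]) ^ (2 * k j) = 2 * 2 ^ (2 * k j - 1) := by
      rw [← pow_succ']; congr 1; have := hk0 j; omega
    rw [hp]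
    push_cast
    field_simp
    ring
  rw [Metric.tendsto_atTop]
  intro ε hε
  obtain ⟨j, hj1, hj2⟩ := ((h1.eventually (gt_mem_nhds (show 0 < ε / 3 by positivity))).and
    (Metric.tendsto_nhds.mp hG (ε / 3) (by positivity))).exists
  obtain ⟨N0, hN0⟩ := Metric.tendsto_atTop.mp (tendsto_vol_pow (2 * k j) (even_two_mul _)) (ε / 3) (by positivity)
  refine ⟨N0, fun N hN => ?_⟩
  have a1 := hN0 N hN
  have a2 := vol_pow_sub_TT (k j) N
  have a3 : ‖((2 * k j + 2 : ℕ) : ℚ_[2])‖ ≤ ‖(k j : ℚ_[2]) + 1‖ := by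
    rw [show ((2 * k j + 2 : ℕ) : ℚ_[2]) = 2 * (k j + 1) by push_cast; ring, norm_mul, n2]
    nlinarith [norm_nonneg ((k j : ℚ_[2]) + 1)]
  rw [dist_eq_norm] at a1 hj2 ⊢
  set V := vol N (fun t => (4 * t + 1 : ℚ_[2]) ^ (2 * k j))
  set G := (2 - 2 ^ (2 * k j)) * ((bernoulli (2 * k j) : ℚ) : ℚ_[2])
  rw [show TT N - 4 * η = -(V - TT N) + (V - G) + (G - 4 * η) by ring]
  have := norm_add₃_le (a := -(V - TT N)) (b := V - G) (c := G - 4 * η)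
  rw [norm_neg] at this
  linarith

/-- The product of linear factors in the denominator, as an integer polynomial function. -/
def QQ (n : ℕ) (t : ℤ) : ℤ := ∏ i ∈ Finset.range (n + 1), (4 * (t - i) + 1)

/-- The basic rational function `binom(t,n) / Q(t)`. -/
noncomputable def gg (n t : ℕ) : ℚ_[2] := (t.choose n : ℚ_[2]) / (QQ n t : ℚ_[2])

lemma norm_QQ (n : ℕ) (t : ℤ) : ‖(QQ n t : ℚ_[2])‖ = 1 := by
  unfold QQ
  push_cast
  rw [norm_prod]
  refine Finset.prod_eq_one (fun i _ => ?_)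
  have := nunit (t - i)
  push_cast at this; exact this

lemma QQ_dvd (n : ℕ) (a b : ℤ) : a - b ∣ QQ n a - QQ n b := by
  have h := Polynomial.sub_dvd_eval_sub a b
    (∏ i ∈ Finset.range (n + 1), (4 * (Polynomial.X - Polynomial.C (i:ℤ)) + 1))
  simp only [Polynomial.eval_prod] at h
  unfold QQ
  simpa using h

lemma norm_nat_le (n : ℕ) : ‖(n : ℚ_[2])‖ ≤ 1 := by
  exact_mod_cast Padic.norm_int_le_one (p := 2) n

lemma norm_ge_of_lt (i k : ℕ) (h0 : 0 < i) (h : i < 2 ^ k) : 2 * ((2:ℝ) ^ k)⁻¹ ≤ ‖(i : ℚ_[2])‖ := by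
  by_contra hc
  push Not at hc
  have h1 : ‖(i : ℚ_[2])‖ ≤ ((2:ℕ):ℝ) ^ (-(k:ℤ)) := by
    rw [Padic.norm_le_pow_iff_norm_lt_pow_add_one, zpow_add₀ (by norm_num), zpow_neg, zpow_natCast]
    push_cast
    linarith
  have h2 := (Padic.norm_int_le_pow_iff_dvd (p := 2) (i:ℤ) k).mp (by exact_mod_cast h1)
  have h3 : 2 ^ k ∣ i := by exact_mod_cast h2
  exact absurd (Nat.le_of_dvd h0 h3) (by omega)

lemma norm_choose_le (k N i : ℕ) (h0 : 0 < i) (h : i < 2 ^ k) :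
    ‖((2 ^ N).choose i : ℚ_[2])‖ ≤ 2 ^ k * (2 ^ (N + 1))⁻¹ := by
  obtain ⟨j, rfl⟩ : ∃ j, i = j + 1 := ⟨i - 1, by omega⟩
  have hM : 2 ^ N = (2 ^ N - 1) + 1 := by have := Nat.one_le_two_pow (n := N); omega
  have h1 := Nat.add_one_mul_choose_eq (2 ^ N - 1) j
  rw [← hM] at h1
  have h2 := congrArg (fun q : ℕ => ‖(q : ℚ_[2])‖) h1
  simp only [Nat.cast_mul, norm_mul] at h2
  have h3 := norm_ge_of_lt (j + 1) k h0 h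
  have h4 := norm_nat_le ((2 ^ N - 1).choose j)
  have h5 : ‖((2 ^ N : ℕ) : ℚ_[2])‖ = (2 ^ N)⁻¹ := by push_cast; exact norm_two_pow N
  rw [h5] at h2
  set c := ‖((2 ^ N).choose (j + 1) : ℚ_[2])‖
  have hc : 0 ≤ c := norm_nonneg _
  have h6 : c * (2 * ((2:ℝ) ^ k)⁻¹) ≤ (2 ^ N)⁻¹ := by
    calc _ ≤ c * ‖((j + 1 : ℕ) : ℚ_[2])‖ := by gcongr
      _ = (2 ^ N)⁻¹ * ‖((2 ^ N - 1).choose j : ℚ_[2])‖ := h2.symm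
      _ ≤ (2 ^ N)⁻¹ * 1 := by gcongr
      _ = _ := mul_one _
  calc c = c * (2 * ((2:ℝ) ^ k)⁻¹) * (2 ^ k / 2) := by field_simp
    _ ≤ (2 ^ N)⁻¹ * (2 ^ k / 2) := by gcongr
    _ = _ := by rw [pow_succ]; field_simp

lemma norm_choose_shift (k N n t : ℕ) (h : n < 2 ^ k) :
    ‖((t + 2 ^ N).choose n : ℚ_[2]) - (t.choose n : ℚ_[2])‖ ≤ 2 ^ k * (2 ^ (N + 1))⁻¹ := by
  have e : ((t + 2 ^ N).choose n : ℚ_[2]) - (t.choose n : ℚ_[2]) =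
      ∑ i ∈ Finset.range n, ((t.choose i : ℚ_[2]) * ((2 ^ N).choose (n - i) : ℚ_[2])) := by
    rw [Nat.add_choose_eq, Finset.Nat.sum_antidiagonal_eq_sum_range_succ_mk, Finset.sum_range_succ]
    push_cast
    simp
  rw [e]
  refine nsum_le _ _ (by positivity) (fun i hi => ?_)
  have hi' : i < n := by simpa using hi
  rw [norm_mul]
  refine (mul_le_of_le_one_left (norm_nonneg _) (norm_nat_le _)).trans ?_
  exact norm_choose_le k N (n - i) (by omega) (by omega)

lemma norm_gg (n t : ℕ) : ‖gg n t‖ ≤ 1 := by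
  unfold gg; rw [norm_div, norm_QQ, div_one]; exact norm_nat_le _

lemma norm_gg_shift (k N n t : ℕ) (hk : 1 ≤ k) (h : n < 2 ^ k) :
    ‖gg n (t + 2 ^ N) - gg n t‖ ≤ 2 ^ k * (2 ^ (N + 1))⁻¹ := by
  have e : gg n (t + 2 ^ N) - gg n t =
    (((t + 2 ^ N).choose n : ℚ_[2]) - (t.choose n : ℚ_[2])) * (QQ n (t + 2 ^ N : ℕ) : ℚ_[2])⁻¹ +
     (t.choose n : ℚ_[2]) * ((QQ n (t + 2 ^ N : ℕ) : ℚ_[2])⁻¹ - (QQ n t : ℚ_[2])⁻¹) := by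
    unfold gg; ring
  rw [e]
  refine nadd_le ?_ ?_
  · rw [norm_mul, norm_inv, norm_QQ, inv_one, mul_one]
    exact norm_choose_shift k N n t h
  · rw [norm_mul, ninv_sub _ _ (norm_QQ _ _) (norm_QQ _ _)]
    refine (mul_le_of_le_one_left (norm_nonneg _) (norm_nat_le _)).trans ?_
    obtain ⟨z, hz⟩ := QQ_dvd n (t + 2 ^ N : ℕ) t
    have hz' := congrArg (fun q : ℤ => (q : ℚ_[2])) hz
    push_cast at hz'
    push_cast
    rw [hz', add_sub_cancel_left, norm_mul, norm_two_pow]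
    have h2 : (2:ℝ) ≤ 2 ^ k := by
      calc (2:ℝ) = 2 ^ 1 := by norm_num
        _ ≤ _ := pow_le_pow_right₀ (by norm_num) hk
    calc _ ≤ ((2:ℝ) ^ N)⁻¹ * 1 := by gcongr; exact Padic.norm_int_le_one _
      _ = 2 * (2 ^ (N + 1))⁻¹ := by rw [pow_succ]; field_simp
      _ ≤ _ := by gcongr

lemma norm_vol_gg (k N : ℕ) (hk1 : 1 ≤ k) (hN : k ≤ N) :
    ‖vol N (fun t => gg (2 ^ k - 1) t ^ 2)‖ = 2 ^ k := by
  set n := 2 ^ k - 1 with hn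
  have h1k := Nat.one_le_two_pow (n := k)
  have hnk : n < 2 ^ k := by omega
  have hk : ‖vol k (fun t => gg n t ^ 2)‖ = 2 ^ k := by
    unfold vol
    rw [norm_mul, norm_two_pow_inv, show 2 ^ k = n + 1 by omega, Finset.sum_range_succ,
      Finset.sum_eq_zero, zero_add]
    · simp [gg, norm_QQ]
    · intro t ht
      have : t < n := by simpa using ht
      simp [gg, Nat.choose_eq_zero_of_lt this]
  have key := vol_bound (fun t => gg n t ^ 2) k (2 ^ k / 2) (by positivity) ?_ N hN
  · have : ‖vol N (fun t => gg n t ^ 2) - vol k (fun t => gg n t ^ 2)‖ <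
        ‖vol k (fun t => gg n t ^ 2)‖ := by
      rw [hk]; refine key.trans_lt ?_
      have : (0:ℝ) < 2 ^ k := by positivity
      linarith
    have h3 := IsUltrametricDist.norm_add_eq_max_of_norm_ne_norm this.ne
    rw [sub_add_cancel, max_eq_right this.le, hk] at h3
    exact h3
  · intro M hM t
    have hd := norm_gg_shift k M n t hk1 hnk
    set d := gg n (t + 2 ^ M) - gg n t with hd'
    have e : gg n (t + 2 ^ M) ^ 2 - gg n t ^ 2 = d * (2 * gg n t + d) := by rw [hd']; ring
    show ‖gg n (t + 2 ^ M) ^ 2 - gg n t ^ 2‖ ≤ _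
    rw [e, norm_mul]
    have h2 : ‖2 * gg n t + d‖ ≤ 2⁻¹ := by
      refine nadd_le ?_ ?_
      · rw [norm_mul, n2]
        exact mul_le_of_le_one_right (by norm_num) (norm_gg n t)
      · refine hd.trans ?_
        have : (2:ℝ) ^ k ≤ 2 ^ M := pow_le_pow_right₀ (by norm_num) hM
        calc _ ≤ (2:ℝ) ^ M * (2 ^ (M + 1))⁻¹ := by gcongr
          _ = 2⁻¹ := by rw [pow_succ]; field_simp
    calc _ ≤ (2 ^ k * (2 ^ (M + 1))⁻¹) * (2:ℝ)⁻¹ := by gcongr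
      _ = _ := by ring

/-- Residue constants of the rational function. -/
def EE (n k : ℕ) : ℚ := (∏ i ∈ Finset.range n, (4 * (k:ℚ) - 1 - 4 * i)) *
  ∏ j ∈ (Finset.range (n + 1)).erase k, (4 * (k:ℚ) - 4 * j)⁻¹

/-- Logarithmic derivative at the pole `4k`. -/
def LL (n k : ℕ) : ℚ := ∑ i ∈ Finset.range n, (4 * (k:ℚ) - 1 - 4 * i)⁻¹ -
  ∑ i ∈ Finset.range (n + 1), (4 * (k:ℚ) - 4 * i)⁻¹

open Polynomial in
lemma eval_derivative_nodal_ne {ι : Type*} [DecidableEq ι] (s : Finset ι) (v : ι → ℚ) (x : ℚ)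
    (h : ∀ i ∈ s, x - v i ≠ 0) :
    (derivative (∏ i ∈ s, (X - C (v i)))).eval x = (∏ i ∈ s, (x - v i)) * ∑ i ∈ s, (x - v i)⁻¹ := by
  rw [Polynomial.derivative_prod_finset, Polynomial.eval_finsetSum, Finset.mul_sum]
  refine Finset.sum_congr rfl (fun i hi => ?_)
  rw [← Finset.mul_prod_erase s _ hi]
  have := h i hi
  simp [Polynomial.eval_prod]
  field_simp

/-- numerator -/
noncomputable def PP (n : ℕ) : Polynomial ℚ :=
  ∏ i ∈ Finset.range n, (Polynomial.X - Polynomial.C (1 + 4 * (i:ℚ)))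

lemma PP_eval (n : ℕ) (x : ℚ) : (PP n).eval x = ∏ i ∈ Finset.range n, (x - 1 - 4 * i) := by
  simp [PP, Polynomial.eval_prod, sub_sub]

lemma node_inj (n : ℕ) : Set.InjOn (fun i : ℕ => 4 * (i:ℚ)) (Finset.range (n + 1)) := by
  intro a _ b _ h
  simpa using h

lemma PP_interp (n : ℕ) : PP n = Lagrange.interpolate (Finset.range (n + 1)) (fun i : ℕ => 4 * (i:ℚ))
    (fun i => (PP n).eval (4 * (i:ℚ))) := by
  refine Lagrange.eq_interpolate (node_inj n) ?_
  rw [PP, Polynomial.degree_prod]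
  simp only [Polynomial.degree_X_sub_C]
  simp
  exact_mod_cast Nat.lt_succ_self n

lemma EE_eq (n k : ℕ) : EE n k = (PP n).eval (4 * (k:ℚ)) *
    Lagrange.nodalWeight (Finset.range (n + 1)) (fun i : ℕ => 4 * (i:ℚ)) k := by
  rw [EE, PP_eval, Lagrange.nodalWeight]

lemma PP_div (n : ℕ) (x : ℚ) (hx : ∀ i ∈ Finset.range (n + 1), x ≠ 4 * (i:ℚ)) :
    (∏ i ∈ Finset.range n, (x - 1 - 4 * i)) / ∏ i ∈ Finset.range (n + 1), (x - 4 * i) =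
    ∑ k ∈ Finset.range (n + 1), EE n k * (x - 4 * k)⁻¹ := by
  have h := Lagrange.eval_interpolate_not_at_node (s := Finset.range (n + 1))
    (v := fun i : ℕ => 4 * (i:ℚ)) (fun i => (PP n).eval (4 * (i:ℚ))) hx
  rw [← PP_interp, PP_eval, Lagrange.eval_nodal] at h
  have h0 : ∏ i ∈ Finset.range (n + 1), (x - 4 * (i:ℚ)) ≠ 0 :=
    Finset.prod_ne_zero_iff.mpr (fun i hi => sub_ne_zero.mpr (hx i hi))
  rw [h, mul_div_cancel_left₀ _ h0]
  refine Finset.sum_congr rfl (fun i _ => ?_)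
  rw [EE_eq]; ring

lemma num_ne (k i : ℕ) : (4 * (k:ℚ) - 1 - 4 * i) ≠ 0 := by
  have : ((4 * (k:ℤ) - 1 - 4 * i : ℤ) : ℚ) ≠ 0 := by
    exact Int.cast_ne_zero.mpr (by omega)
  push_cast at this; exact this

open Polynomial in
lemma EE_LL (n k : ℕ) (hk : k ∈ Finset.range (n + 1)) :
    EE n k * LL n k = ∑ l ∈ Finset.range (n + 1), EE n l * (4 * (k:ℚ) - 4 * l)⁻¹ := by
  classical
  set s := Finset.range (n + 1) with hs
  set v : ℕ → ℚ := fun i => 4 * (i:ℚ) with hv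
  set R : Polynomial ℚ := ∏ i ∈ s.erase k, (X - C (v i)) with hR
  have hvne : ∀ i ∈ s.erase k, v k - v i ≠ 0 := by
    intro i hi
    have : (i:ℚ) ≠ k := by exact_mod_cast (Finset.ne_of_mem_erase hi)
    simp only [hv]
    intro h
    apply this; linarith
  have hP : PP n = C (EE n k) * R + (X - C (v k)) *
      ∑ l ∈ s.erase k, C (EE n l) * ∏ i ∈ (s.erase l).erase k, (X - C (v i)) := by
    conv_lhs => rw [PP_interp, Lagrange.interpolate_apply]
    rw [← hs, ← Finset.add_sum_erase s _ hk, Finset.mul_sum]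
    have hb : ∀ l ∈ s, C (eval (4 * (l:ℚ)) (PP n)) * Lagrange.basis s (fun i : ℕ => 4 * (i:ℚ)) l =
        C (EE n l) * ∏ i ∈ s.erase l, (X - C (v i)) := by
      intro l hl
      rw [EE_eq, Lagrange.basis_eq_prod_sub_inv_mul_nodal_div hl, Lagrange.nodal_erase_eq_nodal_div hl |>.symm, Lagrange.nodal, C_mul]
      ring
    rw [hb k hk]
    congr 1
    refine Finset.sum_congr rfl (fun l hl => ?_)
    rw [hb l (Finset.mem_of_mem_erase hl)]
    have : k ∈ s.erase l := Finset.mem_erase.mpr ⟨(Finset.ne_of_mem_erase hl).symm, hk⟩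
    rw [← Finset.mul_prod_erase _ _ this]
    ring
  have hW : R.eval (v k) ≠ 0 := by
    rw [hR, eval_prod]
    refine Finset.prod_ne_zero_iff.mpr (fun i hi => ?_)
    simpa using hvne i hi
  have hP1 := congrArg (fun q => eval (v k) q) hP
  have hd := congrArg (fun q => eval (v k) (derivative q)) hP
  have hPd : eval (v k) (derivative (PP n)) = eval (v k) (PP n) *
      ∑ i ∈ Finset.range n, (4 * (k:ℚ) - 1 - 4 * i)⁻¹ := by
    rw [PP, eval_derivative_nodal_ne]
    · rw [eval_prod]; simp [hv, sub_sub]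
    · intro i _
      have := num_ne k i
      simp only [hv]; rwa [← sub_sub]
  have hRd : eval (v k) (derivative R) = eval (v k) R * ∑ i ∈ s.erase k, (v k - v i)⁻¹ := by
    rw [hR, eval_derivative_nodal_ne _ _ _ hvne, eval_prod]; simp
  simp only [eval_add, eval_mul, eval_sub, eval_X, eval_C, sub_self, zero_mul, add_zero] at hP1
  simp only [derivative_add, derivative_mul, derivative_C, derivative_sub, derivative_X, eval_add,
    eval_mul, eval_sub, eval_X, eval_C, sub_self, zero_mul, add_zero, zero_add, sub_zero,
    one_mul, hPd, hRd, hP1, eval_finsetSum] at hd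
  have hS : ∑ l ∈ s.erase k, EE n l * eval (v k) (∏ i ∈ (s.erase l).erase k, (X - C (v i))) =
      eval (v k) R * ∑ l ∈ s.erase k, EE n l * (v k - v l)⁻¹ := by
    rw [Finset.mul_sum]
    refine Finset.sum_congr rfl (fun l hl => ?_)
    have h1 := hvne l hl
    rw [hR, ← Finset.mul_prod_erase _ _ hl, Finset.erase_right_comm]
    simp only [eval_mul, eval_sub, eval_X, eval_C]
    field_simp
  rw [hS] at hd
  have e1 : ∑ l ∈ s, EE n l * (4 * (k:ℚ) - 4 * l)⁻¹ = ∑ l ∈ s.erase k, EE n l * (v k - v l)⁻¹ := by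
    rw [← Finset.add_sum_erase s _ hk]; simp [hv]
  have e2 : ∑ i ∈ s, (4 * (k:ℚ) - 4 * i)⁻¹ = ∑ i ∈ s.erase k, (v k - v i)⁻¹ := by
    rw [← Finset.add_sum_erase s _ hk]; simp [hv]
  rw [e1, LL, ← hs, e2]
  apply mul_left_cancel₀ hW
  linear_combination hd

lemma sq_expand (n : ℕ) (x : ℚ) (hx : ∀ i ∈ Finset.range (n + 1), x ≠ 4 * (i:ℚ)) :
    (∑ k ∈ Finset.range (n + 1), EE n k * (x - 4 * k)⁻¹) ^ 2 =
    ∑ k ∈ Finset.range (n + 1), (EE n k ^ 2 * ((x - 4 * k) ^ 2)⁻¹ +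
      2 * EE n k ^ 2 * LL n k * (x - 4 * k)⁻¹) := by
  set s := Finset.range (n + 1) with hs
  have h1 : ∀ k ∈ s, ∀ l ∈ s, EE n k * (x - 4 * k)⁻¹ * (EE n l * (x - 4 * l)⁻¹) =
      (if k = l then EE n k ^ 2 * ((x - 4 * k) ^ 2)⁻¹ else 0) +
      (EE n k * (x - 4 * k)⁻¹ * (EE n l * (4 * (k:ℚ) - 4 * l)⁻¹) +
       EE n l * (x - 4 * l)⁻¹ * (EE n k * (4 * (l:ℚ) - 4 * k)⁻¹)) := by
    intro k hk l hl
    by_cases h : k = l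
    · subst h; rw [if_pos rfl, sub_self, inv_zero, ← inv_pow]; ring
    · have hk' := sub_ne_zero.mpr (hx k hk)
      have hl' := sub_ne_zero.mpr (hx l hl)
      have hkl : (k:ℚ) - l ≠ 0 := sub_ne_zero.mpr (by exact_mod_cast h)
      have hlk : (4 * (l:ℚ) - 4 * k)⁻¹ = - (4 * (k:ℚ) - 4 * l)⁻¹ := by rw [← inv_neg]; ring
      rw [if_neg h, hlk, ← mul_sub]
      field_simp
      ring
  rw [sq, Finset.sum_mul_sum, Finset.sum_congr rfl (fun k hk => Finset.sum_congr rfl (h1 k hk))]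
  simp only [Finset.sum_add_distrib]
  have h2 : ∑ k ∈ s, ∑ l ∈ s, EE n l * (x - 4 * l)⁻¹ * (EE n k * (4 * (l:ℚ) - 4 * k)⁻¹) =
      ∑ k ∈ s, ∑ l ∈ s, EE n k * (x - 4 * k)⁻¹ * (EE n l * (4 * (k:ℚ) - 4 * l)⁻¹) :=
    Finset.sum_comm
  rw [h2]
  have h3 : ∑ k ∈ s, ∑ l ∈ s, EE n k * (x - 4 * k)⁻¹ * (EE n l * (4 * (k:ℚ) - 4 * l)⁻¹) =
      ∑ k ∈ s, EE n k ^ 2 * LL n k * (x - 4 * k)⁻¹ := by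
    refine Finset.sum_congr rfl (fun k hk => ?_)
    rw [← Finset.mul_sum, ← EE_LL n k hk]; ring
  rw [h3]
  congr 1
  · refine Finset.sum_congr rfl (fun k hk => ?_)
    simp [hk]
  · rw [← Finset.sum_add_distrib]
    refine Finset.sum_congr rfl (fun k hk => ?_)
    ring

lemma sum_CC (n : ℕ) : ∑ k ∈ Finset.range (n + 1), 2 * EE n k ^ 2 * LL n k = 0 := by
  set s := Finset.range (n + 1) with hs
  have h3 : ∑ k ∈ s, 2 * EE n k ^ 2 * LL n k = 
     2 * ∑ k ∈ s, ∑ l ∈ s, EE n k * (EE n l * (4 * (k:ℚ) - 4 * l)⁻¹)  := by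
    rw [Finset.mul_sum]
    refine Finset.sum_congr rfl (fun k hk => ?_)
    rw [← Finset.mul_sum, ← EE_LL n k hk]; ring
  rw [h3]
  have h4 : ∑ k ∈ s, ∑ l ∈ s, EE n k * (EE n l * (4 * (k:ℚ) - 4 * l)⁻¹) =
      - ∑ k ∈ s, ∑ l ∈ s, EE n k * (EE n l * (4 * (k:ℚ) - 4 * l)⁻¹) := by
    conv_lhs => rw [Finset.sum_comm]
    rw [← Finset.sum_neg_distrib]
    refine Finset.sum_congr rfl (fun k hk => ?_)
    rw [← Finset.sum_neg_distrib]
    refine Finset.sum_congr rfl (fun l hl => ?_)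
    have hlk : (4 * (l:ℚ) - 4 * k)⁻¹ = - (4 * (k:ℚ) - 4 * l)⁻¹ := by rw [← inv_neg]; ring
    rw [hlk]; ring
  linarith

open Filter Topology

lemma a_ne (z : ℤ) : (4 * z + 1 : ℚ_[2]) ≠ 0 := by
  intro h; have := nunit z; rw [h] at this; simp at this

lemma inv_diff1 (x a w : ℚ_[2]) (hx : x ≠ 0) (ha : a ≠ 0) (hw : w ≠ 0) (h : w = a + 4 * x) :
    x⁻¹ * (a⁻¹ - w⁻¹) = 4 / (a * w) := by
  field_simp
  rw [h]; ring

lemma inv_diff2 (x a w : ℚ_[2]) (hx : x ≠ 0) (ha : a ≠ 0) (hw : w ≠ 0) (h : w = a + 4 * x) :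
    x⁻¹ * ((a ^ 2)⁻¹ - (w ^ 2)⁻¹) = 4 * (2 * a + 4 * x) / (a ^ 2 * w ^ 2) := by
  field_simp
  rw [h]; ring

lemma vol_shift (h : ℤ → ℚ_[2]) (N k : ℕ) :
    vol N (fun t => h ((t:ℤ) - k)) = vol N (fun t => h t) +
      ∑ m ∈ Finset.range k, ((2:ℚ_[2]) ^ N)⁻¹ * (h (-((m:ℤ) + 1)) - h (2 ^ N - ((m:ℤ) + 1))) := by
  induction k with
  | zero => simp
  | succ k ih =>
    rw [Finset.sum_range_succ, ← add_assoc, ← ih]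
    unfold vol
    rw [← mul_add]
    congr 1
    have h1 := Finset.sum_range_succ (fun t : ℕ => h ((t:ℤ) - (k + 1 : ℕ))) (2 ^ N)
    rw [Finset.sum_range_succ'] at h1
    have e : ∀ t : ℕ, (((t + 1 : ℕ) : ℤ) - (k + 1 : ℕ)) = t - k := by intro t; push_cast; ring
    simp only [e] at h1
    have e2 : ((0:ℕ):ℤ) - (k + 1 : ℕ) = -((k:ℤ) + 1) := by push_cast; ring
    have e3 : ((2 ^ N:ℕ):ℤ) - (k + 1 : ℕ) = 2 ^ N -((k:ℤ) + 1) := by push_cast; ring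
    rw [e2, e3] at h1
    linear_combination -h1

lemma lim_h1 (m : ℕ) : Tendsto (fun N : ℕ => ((2:ℚ_[2]) ^ N)⁻¹ *
    ((4 * ((-((m:ℤ) + 1) : ℤ) : ℚ_[2]) + 1)⁻¹ - (4 * ((2 ^ N - ((m:ℤ) + 1) : ℤ) : ℚ_[2]) + 1)⁻¹))
    atTop (𝓝 (4 / (1 - 4 * ((m:ℚ_[2]) + 1)) ^ 2)) := by
  have ha : (1 - 4 * ((m:ℚ_[2]) + 1)) ≠ 0 := by
    have := a_ne (-((m:ℤ) + 1)); push_cast at this; intro h; apply this; linear_combination h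
  have e : ∀ N : ℕ, ((2:ℚ_[2]) ^ N)⁻¹ *
    ((4 * ((-((m:ℤ) + 1) : ℤ) : ℚ_[2]) + 1)⁻¹ - (4 * ((2 ^ N - ((m:ℤ) + 1) : ℤ) : ℚ_[2]) + 1)⁻¹) =
      4 / ((1 - 4 * ((m:ℚ_[2]) + 1)) * (1 - 4 * ((m:ℚ_[2]) + 1) + 4 * 2 ^ N)) := by
    intro N
    have h1 : (2:ℚ_[2]) ^ N ≠ 0 := pow_ne_zero _ two_ne_zero
    have h2 := a_ne (2 ^ N - ((m:ℤ) + 1))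
    push_cast at h2 ⊢
    have e1 : (4 * (2 ^ N - ((m:ℚ_[2]) + 1)) + 1) = 1 - 4 * ((m:ℚ_[2]) + 1) + 4 * 2 ^ N := by ring
    have e2 : (4 * (- ((m:ℚ_[2]) + 1)) + 1) = 1 - 4 * ((m:ℚ_[2]) + 1) := by ring
    rw [e1] at h2 ⊢
    rw [e2]
    exact inv_diff1 _ _ _ h1 ha h2 rfl
  simp only [e]
  have ht : Tendsto (fun N : ℕ => (1 - 4 * ((m:ℚ_[2]) + 1)) * (1 - 4 * ((m:ℚ_[2]) + 1) + 4 * 2 ^ N)) atTop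
      (𝓝 ((1 - 4 * ((m:ℚ_[2]) + 1)) * (1 - 4 * ((m:ℚ_[2]) + 1) + 4 * 0))) :=
    ((tendsto_two_pow.const_mul 4).const_add _).const_mul _
  rw [mul_zero, add_zero, ← sq] at ht
  exact tendsto_const_nhds.div ht (pow_ne_zero _ ha)

lemma lim_h2 (m : ℕ) : Tendsto (fun N : ℕ => ((2:ℚ_[2]) ^ N)⁻¹ *
    (((4 * ((-((m:ℤ) + 1) : ℤ) : ℚ_[2]) + 1) ^ 2)⁻¹ - ((4 * ((2 ^ N - ((m:ℤ) + 1) : ℤ) : ℚ_[2]) + 1) ^ 2)⁻¹))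
    atTop (𝓝 (8 / (1 - 4 * ((m:ℚ_[2]) + 1)) ^ 3)) := by
  have ha : (1 - 4 * ((m:ℚ_[2]) + 1)) ≠ 0 := by
    have := a_ne (-((m:ℤ) + 1)); push_cast at this; intro h; apply this; linear_combination h
  have e : ∀ N : ℕ, ((2:ℚ_[2]) ^ N)⁻¹ *
    (((4 * ((-((m:ℤ) + 1) : ℤ) : ℚ_[2]) + 1) ^ 2)⁻¹ - ((4 * ((2 ^ N - ((m:ℤ) + 1) : ℤ) : ℚ_[2]) + 1) ^ 2)⁻¹) =
      4 * (2 * (1 - 4 * ((m:ℚ_[2]) + 1)) + 4 * 2 ^ N) /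
        ((1 - 4 * ((m:ℚ_[2]) + 1)) ^ 2 * (1 - 4 * ((m:ℚ_[2]) + 1) + 4 * 2 ^ N) ^ 2) := by
    intro N
    have h1 : (2:ℚ_[2]) ^ N ≠ 0 := pow_ne_zero _ two_ne_zero
    have h2 := a_ne (2 ^ N - ((m:ℤ) + 1))
    push_cast at h2 ⊢
    have e1 : (4 * (2 ^ N - ((m:ℚ_[2]) + 1)) + 1) = 1 - 4 * ((m:ℚ_[2]) + 1) + 4 * 2 ^ N := by ring
    have e2 : (4 * (- ((m:ℚ_[2]) + 1)) + 1) = 1 - 4 * ((m:ℚ_[2]) + 1) := by ring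
    rw [e1] at h2 ⊢
    rw [e2]
    exact inv_diff2 _ _ _ h1 ha h2 rfl
  simp only [e]
  have ht : Tendsto (fun N : ℕ => (1 - 4 * ((m:ℚ_[2]) + 1)) ^ 2 * (1 - 4 * ((m:ℚ_[2]) + 1) + 4 * 2 ^ N) ^ 2) atTop
      (𝓝 ((1 - 4 * ((m:ℚ_[2]) + 1)) ^ 2 * (1 - 4 * ((m:ℚ_[2]) + 1) + 4 * 0) ^ 2)) :=
    (((tendsto_two_pow.const_mul 4).const_add _).pow 2).const_mul _
  have ht2 : Tendsto (fun N : ℕ => 4 * (2 * (1 - 4 * ((m:ℚ_[2]) + 1)) + 4 * 2 ^ N)) atTop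
      (𝓝 (4 * (2 * (1 - 4 * ((m:ℚ_[2]) + 1)) + 4 * 0))) :=
    ((tendsto_two_pow.const_mul 4).const_add _).const_mul _
  rw [mul_zero, add_zero] at ht ht2
  have := ht2.div ht (mul_ne_zero (pow_ne_zero _ ha) (pow_ne_zero _ ha))
  have e3 : 4 * (2 * (1 - 4 * ((m:ℚ_[2]) + 1))) / ((1 - 4 * ((m:ℚ_[2]) + 1)) ^ 2 *
      (1 - 4 * ((m:ℚ_[2]) + 1)) ^ 2) = 8 / (1 - 4 * ((m:ℚ_[2]) + 1)) ^ 3 := by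
    generalize 1 - 4 * ((m:ℚ_[2]) + 1) = a at *
    field_simp
    norm_num
  rw [← e3]
  exact this

/-- Coefficient of zeta. -/
def qn (n : ℕ) : ℚ := ∑ k ∈ Finset.range (n + 1), EE n k ^ 2

/-- Rational part. -/
def pn (n : ℕ) : ℚ := ∑ k ∈ Finset.range (n + 1), ∑ m ∈ Finset.range k,
  (EE n k ^ 2 * (8 / (1 - 4 * ((m:ℚ) + 1)) ^ 3) +
    2 * EE n k ^ 2 * LL n k * (4 / (1 - 4 * ((m:ℚ) + 1)) ^ 2))

lemma gg_expand_rat (n t : ℕ) : ((4 ^ n * n.factorial * t.choose n : ℚ) / (QQ n t : ℚ)) ^ 2 =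
    ∑ k ∈ Finset.range (n + 1), (EE n k ^ 2 * ((4 * (((t:ℤ) - k : ℤ) : ℚ) + 1) ^ 2)⁻¹ +
      2 * EE n k ^ 2 * LL n k * (4 * (((t:ℤ) - k : ℤ) : ℚ) + 1)⁻¹) := by
  have hx : ∀ i ∈ Finset.range (n + 1), (4 * (t:ℚ) + 1) ≠ 4 * (i:ℚ) := by
    intro i _ h
    have : (4 * (t:ℤ) + 1) = 4 * i := by exact_mod_cast h
    omega
  have h := sq_expand n (4 * (t:ℚ) + 1) hx
  rw [← PP_div n _ hx] at h
  have e : ∀ k : ℕ, 4 * (((t:ℤ) - k : ℤ) : ℚ) + 1 = 4 * (t:ℚ) + 1 - 4 * k := by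
    intro k; push_cast; ring
  simp only [e]
  rw [← h]
  congr 2
  · have : (t.choose n * n.factorial : ℚ) = ∏ i ∈ Finset.range n, ((t:ℚ) - i) := by
      rw [← descPochhammer_eval_eq_prod_range, descPochhammer_eval_eq_descFactorial,
        Nat.descFactorial_eq_factorial_mul_choose]
      push_cast; ring
    rw [mul_assoc, mul_comm (n.factorial : ℚ), this, ← Finset.card_range n, ← Finset.prod_const,
      Finset.card_range, ← Finset.prod_mul_distrib]
    refine Finset.prod_congr rfl (fun i _ => ?_)
    ring
  · unfold QQ; push_cast
    refine Finset.prod_congr rfl (fun i _ => ?_)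
    ring

lemma gg_expand (n t : ℕ) : (4 ^ n * n.factorial : ℚ_[2]) ^ 2 * gg n t ^ 2 =
    ∑ k ∈ Finset.range (n + 1), ((EE n k ^ 2 : ℚ) * ((4 * (((t:ℤ) - k : ℤ) : ℚ_[2]) + 1) ^ 2)⁻¹ +
      (2 * EE n k ^ 2 * LL n k : ℚ) * (4 * (((t:ℤ) - k : ℤ) : ℚ_[2]) + 1)⁻¹) := by
  have h := congrArg (fun q : ℚ => (q : ℚ_[2])) (gg_expand_rat n t)
  push_cast at h ⊢
  rw [← h, gg]; ring

lemma vol_expand (n N : ℕ) : (4 ^ n * n.factorial : ℚ_[2]) ^ 2 * vol N (fun t => gg n t ^ 2) =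
    ∑ k ∈ Finset.range (n + 1),
      ((EE n k ^ 2 : ℚ) * vol N (fun t => ((4 * (((t:ℤ) - k : ℤ) : ℚ_[2]) + 1) ^ 2)⁻¹) +
      (2 * EE n k ^ 2 * LL n k : ℚ) * vol N (fun t => (4 * (((t:ℤ) - k : ℤ) : ℚ_[2]) + 1)⁻¹)) := by
  unfold vol
  rw [mul_left_comm, Finset.mul_sum, Finset.sum_congr rfl (fun t _ => gg_expand n t),
    Finset.sum_comm, Finset.mul_sum]
  refine Finset.sum_congr rfl (fun k _ => ?_)
  rw [Finset.sum_add_distrib, ← Finset.mul_sum, ← Finset.mul_sum]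
  ring

lemma tendsto_vol_gg (η : ℚ_[2]) (hT : Tendsto TT atTop (𝓝 (4 * η))) (n : ℕ) :
    Tendsto (fun N => (4 ^ n * n.factorial : ℚ_[2]) ^ 2 * vol N (fun t => gg n t ^ 2)) atTop
      (𝓝 ((qn n : ℚ_[2]) * (4 * η) + (pn n : ℚ_[2]))) := by
  have hC := congrArg (fun q : ℚ => (q : ℚ_[2])) (sum_CC n)
  simp only [Rat.cast_sum, Rat.cast_zero] at hC
  have e : ∀ N, (4 ^ n * n.factorial : ℚ_[2]) ^ 2 * vol N (fun t => gg n t ^ 2) =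
    ∑ k ∈ Finset.range (n + 1),
      ((EE n k ^ 2 : ℚ) * (TT N + ∑ m ∈ Finset.range k, ((2:ℚ_[2]) ^ N)⁻¹ *
    (((4 * ((-((m:ℤ) + 1) : ℤ) : ℚ_[2]) + 1) ^ 2)⁻¹ - ((4 * ((2 ^ N - ((m:ℤ) + 1) : ℤ) : ℚ_[2]) + 1) ^ 2)⁻¹)) +
      (2 * EE n k ^ 2 * LL n k : ℚ) * ∑ m ∈ Finset.range k, ((2:ℚ_[2]) ^ N)⁻¹ *
    ((4 * ((-((m:ℤ) + 1) : ℤ) : ℚ_[2]) + 1)⁻¹ - (4 * ((2 ^ N - ((m:ℤ) + 1) : ℤ) : ℚ_[2]) + 1)⁻¹)) := by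
    intro N
    rw [vol_expand]
    have h1 := fun k => vol_shift (fun z => (4 * (z : ℚ_[2]) + 1)⁻¹) N k
    have h2 := fun k => vol_shift (fun z => ((4 * (z : ℚ_[2]) + 1) ^ 2)⁻¹) N k
    simp only [h1, h2]
    have hTT : vol N (fun t => ((4 * ((t:ℤ) : ℚ_[2]) + 1) ^ 2)⁻¹) = TT N := by
      unfold TT; simp
    rw [hTT, ← sub_eq_zero, ← Finset.sum_sub_distrib]
    have := congrArg (fun q => q * vol N (fun t => (4 * ((t:ℤ) : ℚ_[2]) + 1)⁻¹)) hC
    simp only [Finset.sum_mul, zero_mul] at this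
    rw [← this]
    refine Finset.sum_congr rfl (fun k _ => ?_)
    ring
  simp only [e]
  have hlim : ((qn n : ℚ_[2]) * (4 * η) + (pn n : ℚ_[2])) = ∑ k ∈ Finset.range (n + 1),
      ((EE n k ^ 2 : ℚ) * ((4 * η) + ∑ m ∈ Finset.range k, (8 / (1 - 4 * ((m:ℚ_[2]) + 1)) ^ 3)) +
      (2 * EE n k ^ 2 * LL n k : ℚ) * ∑ m ∈ Finset.range k, (4 / (1 - 4 * ((m:ℚ_[2]) + 1)) ^ 2)) := by
    unfold qn pn
    push_cast
    rw [Finset.sum_mul, ← Finset.sum_add_distrib]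
    refine Finset.sum_congr rfl (fun k _ => ?_)
    rw [Finset.sum_add_distrib, ← Finset.mul_sum, ← Finset.mul_sum]
    ring
  rw [hlim]
  refine tendsto_finsetSum _ (fun k _ => ?_)
  exact ((hT.add (tendsto_finsetSum _ (fun m _ => lim_h2 m))).const_mul _).add
    ((tendsto_finsetSum _ (fun m _ => lim_h1 m)).const_mul _)

lemma norm_form (η : ℚ_[2]) (hT : Tendsto TT atTop (𝓝 (4 * η))) (k : ℕ) (hk : 1 ≤ k) :
    ‖(qn (2 ^ k - 1) : ℚ_[2]) * (4 * η) + (pn (2 ^ k - 1) : ℚ_[2])‖ =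
      ‖(4 ^ (2 ^ k - 1) * (2 ^ k - 1).factorial : ℚ_[2])‖ ^ 2 * 2 ^ k := by
  have h := (tendsto_vol_gg η hT (2 ^ k - 1)).norm
  refine tendsto_nhds_unique h (tendsto_const_nhds.congr' ?_)
  filter_upwards [eventually_ge_atTop k] with N hN
  rw [norm_mul (_ ^ 2), norm_vol_gg k N hk hN, norm_pow]

lemma prod_erase_val (k r : ℕ) : ∏ j ∈ (Finset.range (k + r + 1)).erase k, (4 * (k:ℚ) - 4 * j) =
    4 ^ (k + r) * (-1) ^ r * k.factorial * r.factorial := by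
  have h1 : ∏ j ∈ (Finset.range (k + r + 1)).erase k, (4 * (k:ℚ) - 4 * j) =
     ∏ j ∈ (Finset.range (k + r + 1)).erase k, (if j = k then 1 else (4 * (k:ℚ) - 4 * j)) := by
    refine Finset.prod_congr rfl (fun j hj => ?_)
    rw [if_neg (Finset.ne_of_mem_erase hj)]
  rw [h1, Finset.prod_erase _ (by simp), add_assoc, Finset.prod_range_add, Finset.prod_range_succ']
  have h2 : ∏ x ∈ Finset.range k, (if x = k then 1 else (4 * (k:ℚ) - 4 * x)) = 4 ^ k * k.factorial := by
    rw [← Finset.prod_range_reflect]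
    have : (4 : ℚ) ^ k * k.factorial = ∏ x ∈ Finset.range k, (4 * ((x:ℚ) + 1)) := by
      rw [Finset.prod_mul_distrib, Finset.prod_const, Finset.card_range]
      congr 1
      exact_mod_cast (Finset.prod_range_add_one_eq_factorial k).symm
    rw [this]
    refine Finset.prod_congr rfl (fun j hj => ?_)
    have hj' : j < k := by simpa using hj
    rw [if_neg (by omega), Nat.sub_sub, Nat.cast_sub (by omega)]
    push_cast; ring
  have h3 : ∏ x ∈ Finset.range r, (if k + (x + 1) = k then 1 else (4 * (k:ℚ) - 4 * ((k + (x + 1) : ℕ) : ℚ))) =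
      4 ^ r * (-1) ^ r * r.factorial := by
    have : (4 : ℚ) ^ r * (-1) ^ r * r.factorial = ∏ x ∈ Finset.range r, (4 * (-1) * ((x:ℚ) + 1)) := by
      rw [Finset.prod_mul_distrib, Finset.prod_const, Finset.card_range, mul_pow]
      congr 1
      exact_mod_cast (Finset.prod_range_add_one_eq_factorial r).symm
    rw [this]
    refine Finset.prod_congr rfl (fun j hj => ?_)
    rw [if_neg (by omega)]
    push_cast; ring
  rw [h2, h3]
  simp
  ring

lemma prod_num_le (k r : ℕ) : |∏ i ∈ Finset.range (k + r), (4 * (k:ℚ) - 1 - 4 * i)| ≤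
    4 ^ (k + r) * k.factorial * r.factorial := by
  rw [Finset.prod_range_add, abs_mul, Finset.abs_prod, Finset.abs_prod]
  have h2 : ∏ x ∈ Finset.range k, |4 * (k:ℚ) - 1 - 4 * x| ≤ 4 ^ k * k.factorial := by
    rw [← Finset.prod_range_reflect]
    have : (4 : ℚ) ^ k * k.factorial = ∏ x ∈ Finset.range k, (4 * ((x:ℚ) + 1)) := by
      rw [Finset.prod_mul_distrib, Finset.prod_const, Finset.card_range]
      congr 1
      exact_mod_cast (Finset.prod_range_add_one_eq_factorial k).symm
    rw [this]
    refine Finset.prod_le_prod (fun j _ => abs_nonneg _) (fun j hj => ?_)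
    have hj' : j < k := by simpa using hj
    rw [Nat.sub_sub, Nat.cast_sub (by omega)]
    have : (0:ℚ) ≤ j := by positivity
    push_cast
    rw [abs_le]; constructor <;> linarith
  have h3 : ∏ x ∈ Finset.range r, |4 * (k:ℚ) - 1 - 4 * ((k + x : ℕ) : ℚ)| ≤ 4 ^ r * r.factorial := by
    have : (4 : ℚ) ^ r * r.factorial = ∏ x ∈ Finset.range r, (4 * ((x:ℚ) + 1)) := by
      rw [Finset.prod_mul_distrib, Finset.prod_const, Finset.card_range]
      congr 1
      exact_mod_cast (Finset.prod_range_add_one_eq_factorial r).symm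
    rw [this]
    refine Finset.prod_le_prod (fun j _ => abs_nonneg _) (fun j hj => ?_)
    have : (0:ℚ) ≤ j := by positivity
    push_cast
    rw [abs_le]; constructor <;> linarith
  calc _ ≤ (4 ^ k * k.factorial : ℚ) * (4 ^ r * r.factorial) := by
        gcongr
    _ = _ := by ring

/-- The binomial coefficient `binom(k - 1/4, n)`. -/
def bb (n k : ℕ) : ℚ := (∏ i ∈ Finset.range n, (4 * (k:ℚ) - 1 - 4 * i)) / (4 ^ n * n.factorial)

lemma EE_sq (n k : ℕ) (hk : k ≤ n) : EE n k ^ 2 = (n.choose k : ℚ) ^ 2 * bb n k ^ 2 := by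
  obtain ⟨r, rfl⟩ := Nat.exists_eq_add_of_le hk
  rw [EE, Finset.prod_inv_distrib, prod_erase_val, bb, Nat.cast_add_choose]
  have h1 : (((-1:ℚ)) ^ r) ^ 2 = 1 := by rw [← pow_mul, mul_comm, pow_mul]; simp
  have h2 := Nat.factorial_ne_zero k
  have h3 := Nat.factorial_ne_zero r
  have h4 := Nat.factorial_ne_zero (k + r)
  field_simp
  rw [h1, mul_one]

lemma EE_sq_le (n k : ℕ) (hk : k ≤ n) : EE n k ^ 2 ≤ 1 := by
  obtain ⟨r, rfl⟩ := Nat.exists_eq_add_of_le hk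
  rw [sq_le_one_iff_abs_le_one, EE, Finset.prod_inv_distrib, prod_erase_val, abs_mul, abs_inv,
    ← div_eq_mul_inv, div_le_one]
  · refine (prod_num_le k r).trans (le_of_eq ?_)
    simp only [abs_mul, abs_pow, abs_neg, abs_one, one_pow, mul_one, Nat.abs_cast]
    norm_num
  · have h2 := Nat.factorial_ne_zero k
    have h3 := Nat.factorial_ne_zero r
    positivity

lemma abs_num_inv_le (k i : ℕ) : |(4 * (k:ℚ) - 1 - 4 * i)⁻¹| ≤ 1 := by
  rw [abs_inv]
  apply inv_le_one_of_one_le₀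
  have : ((4 * (k:ℤ) - 1 - 4 * i : ℤ) : ℚ) = 4 * (k:ℚ) - 1 - 4 * i := by push_cast; ring
  rw [← this, ← Int.cast_abs]
  have h0 : (4 * (k:ℤ) - 1 - 4 * i) ≠ 0 := by omega
  exact_mod_cast Int.one_le_abs h0

lemma abs_den_inv_le (k i : ℕ) : |(4 * (k:ℚ) - 4 * i)⁻¹| ≤ 1 := by
  by_cases h : k = i
  · subst h; simp
  rw [abs_inv]
  apply inv_le_one_of_one_le₀
  have : ((4 * (k:ℤ) - 4 * i : ℤ) : ℚ) = 4 * (k:ℚ) - 4 * i := by push_cast; ring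
  rw [← this, ← Int.cast_abs]
  have h0 : (4 * (k:ℤ) - 4 * i) ≠ 0 := by omega
  exact_mod_cast Int.one_le_abs h0

lemma LL_le (n k : ℕ) : |LL n k| ≤ 2 * n + 1 := by
  unfold LL
  refine (abs_sub _ _).trans ?_
  have h1 : |∑ i ∈ Finset.range n, (4 * (k:ℚ) - 1 - 4 * i)⁻¹| ≤ n := by
    refine (Finset.abs_sum_le_sum_abs _ _).trans ?_
    refine (Finset.sum_le_card_nsmul _ _ 1 (fun i _ => abs_num_inv_le k i)).trans ?_
    simp
  have h2 : |∑ i ∈ Finset.range (n + 1), (4 * (k:ℚ) - 4 * i)⁻¹| ≤ n + 1 := by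
    refine (Finset.abs_sum_le_sum_abs _ _).trans ?_
    refine (Finset.sum_le_card_nsmul _ _ 1 (fun i _ => abs_den_inv_le k i)).trans ?_
    simp
  linarith

lemma qn_le (n : ℕ) : |qn n| ≤ n + 1 := by
  unfold qn
  refine (Finset.abs_sum_le_sum_abs _ _).trans ?_
  refine (Finset.sum_le_card_nsmul _ _ 1 (fun k hk => ?_)).trans ?_
  · have hk' : k < n + 1 := by simpa using hk
    rw [abs_of_nonneg (sq_nonneg _)]
    exact EE_sq_le n k (by omega)
  · simp

lemma pn_le (n : ℕ) : |pn n| ≤ 16 * (n + 1) ^ 3 := by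
  unfold pn
  refine (Finset.abs_sum_le_sum_abs _ _).trans ?_
  refine (Finset.sum_le_card_nsmul _ _ ((n:ℚ) * (16 * n + 16)) (fun k hk => ?_)).trans ?_
  · have hk' : k < n + 1 := by simpa using hk
    have hE := EE_sq_le n k (by omega)
    have hE0 := sq_nonneg (EE n k)
    have hL := LL_le n k
    refine (Finset.abs_sum_le_sum_abs _ _).trans ?_
    refine (Finset.sum_le_card_nsmul _ _ (16 * (n:ℚ) + 16) (fun m hm => ?_)).trans ?_
    · set x := (1 - 4 * ((m:ℚ) + 1))⁻¹ with hx
      have hx1 : |x| ≤ 1 := by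
        have := abs_num_inv_le 0 m
        rw [hx, ← abs_neg, ← inv_neg]
        have hm0 : (0:ℚ) ≤ m := by positivity
        rw [abs_inv]
        apply inv_le_one_of_one_le₀
        rw [abs_of_nonneg] <;> linarith
      have e : EE n k ^ 2 * (8 / (1 - 4 * ((m:ℚ) + 1)) ^ 3) +
          2 * EE n k ^ 2 * LL n k * (4 / (1 - 4 * ((m:ℚ) + 1)) ^ 2) =
          EE n k ^ 2 * (8 * x ^ 3) + EE n k ^ 2 * (8 * LL n k * x ^ 2) := by
        rw [hx]; simp only [div_eq_mul_inv, inv_pow]; ring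
      rw [e]
      refine (abs_add_le _ _).trans ?_
      simp only [abs_mul, abs_pow]
      rw [← abs_pow, abs_of_nonneg hE0]
      have h3 : |x| ^ 3 ≤ 1 := pow_le_one₀ (abs_nonneg _) hx1
      have h2 : |x| ^ 2 ≤ 1 := pow_le_one₀ (abs_nonneg _) hx1
      have h8 : |(8:ℚ)| = 8 := by norm_num
      rw [h8]
      calc _ ≤ (1:ℚ) * (8 * 1) + 1 * (8 * (2 * n + 1) * 1) := by gcongr
        _ = _ := by ring
    · simp only [Finset.card_range, nsmul_eq_mul]
      have : (k:ℚ) ≤ n := by exact_mod_cast (by omega : k ≤ n)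
      gcongr
  · simp only [Finset.card_range, nsmul_eq_mul]
    have : (0:ℚ) ≤ n := by positivity
    push_cast
    nlinarith [sq_nonneg (n:ℚ)]

/-- The integers inside the rationals. -/
def ZS : Subring ℚ := (Int.castRingHom ℚ).range

lemma ZS_int (z : ℤ) : (z : ℚ) ∈ ZS := ⟨z, rfl⟩
lemma ZS_nat (z : ℕ) : (z : ℚ) ∈ ZS := ⟨z, by simp⟩
lemma ZS_div (a b : ℤ) (h : b ∣ a) : (a : ℚ) / b ∈ ZS := by
  obtain ⟨c, rfl⟩ := h
  by_cases hb : (b:ℚ) = 0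
  · rw [hb]; simp [ZS.zero_mem]
  · push_cast; rw [mul_div_cancel_left₀ _ hb]; exact ZS_int c

lemma fact_dvd_int (m : ℕ) (c : ℤ) : (m.factorial : ℤ) ∣ ∏ i ∈ Finset.range m, (c - i) := by
  rw [← descPochhammer_eval_eq_prod_range]
  have h := Ring.descPochhammer_eq_factorial_smul_choose c m
  refine ⟨Ring.choose c m, ?_⟩
  rw [nsmul_eq_mul] at h
  rw [← h, Polynomial.eval_eq_smeval]

lemma fact_dvd (m : ℕ) (c : ℤ) : (m.factorial : ℤ) ∣ 2 ^ m * ∏ i ∈ Finset.range m, (c - 4 * i) := by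
  obtain ⟨v, o, ho, hvo⟩ := Nat.exists_eq_two_pow_mul_odd (Nat.factorial_ne_zero m)
  have hv : v ≤ m := by
    by_cases hm : m = 0
    · subst hm
      by_contra hc
      have : 2 ∣ Nat.factorial 0 := by
        rw [hvo]; exact Dvd.dvd.mul_right (dvd_pow_self 2 (by omega)) _
      simp at this
    · have h1 := Nat.emultiplicity_two_factorial_lt hm
      have h2 : 2 ^ v ∣ m.factorial := ⟨o, hvo⟩
      have h3 := le_emultiplicity_of_pow_dvd h2
      have h4 := h3.trans_lt h1
      exact_mod_cast h4.le
  have hco : IsCoprime (o : ℤ) 4 := by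
    have h1 : Nat.Coprime o (2 ^ 2) := Nat.Coprime.pow_right 2 (Nat.coprime_two_right.mpr ho)
    have h2 := Nat.isCoprime_iff_coprime.mpr h1
    norm_num at h2
    exact h2
  obtain ⟨a, u, hu⟩ := hco
  have h1 : (o : ℤ) ∣ ∏ i ∈ Finset.range m, (c - 4 * i) := by
    have e1 : (∏ i ∈ Finset.range m, (c - 4 * (i:ℤ))) ≡
        ∏ i ∈ Finset.range m, (4 * (u * c - i)) [ZMOD o] := by
      refine Int.ModEq.prod (fun i _ => ?_)
      rw [Int.modEq_iff_dvd]
      exact ⟨-(a * c), by linear_combination c * hu⟩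
    have e2 : (o : ℤ) ∣ ∏ i ∈ Finset.range m, (4 * (u * c - i)) := by
      rw [Finset.prod_mul_distrib]
      refine Dvd.dvd.mul_left ?_ _
      refine Dvd.dvd.trans ?_ (fact_dvd_int m (u * c))
      exact ⟨2 ^ v, by rw [hvo]; push_cast; ring⟩
    exact (Int.ModEq.dvd_iff e1).mpr e2
  rw [hvo]; push_cast
  exact mul_dvd_mul (pow_dvd_pow 2 hv) h1

lemma choose_eq_prod (y : ℚ) (m : ℕ) :
    Ring.choose y m = (∏ i ∈ Finset.range m, (y - i)) / m.factorial := by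
  rw [Ring.choose_eq_smul, smul_eq_mul, ← descPochhammer_eval_eq_prod_range, div_eq_inv_mul,
    ← descPochhammer_map (Int.castRingHom ℚ), Polynomial.eval_map, ← Polynomial.aeval_eq_smeval]
  rfl

lemma choose_quarter (c : ℤ) (m : ℕ) :
    Ring.choose ((c:ℚ) / 4) m = (∏ i ∈ Finset.range m, ((c:ℚ) - 4 * i)) / (4 ^ m * m.factorial) := by
  rw [choose_eq_prod]
  have : ∏ i ∈ Finset.range m, ((c:ℚ) - 4 * i) = 4 ^ m * ∏ i ∈ Finset.range m, ((c:ℚ) / 4 - i) := by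
    rw [← Finset.card_range m, ← Finset.prod_const, Finset.card_range, ← Finset.prod_mul_distrib]
    refine Finset.prod_congr rfl (fun i _ => by ring)
  rw [this, mul_div_mul_left _ _ (by positivity)]

lemma choose_quarter_mem (c : ℤ) (m : ℕ) : 8 ^ m * Ring.choose ((c:ℚ) / 4) m ∈ ZS := by
  have h := ZS_div _ _ (fact_dvd m c)
  convert h using 1
  rw [choose_quarter]
  push_cast
  rw [show (8:ℚ) = 2 * 4 by norm_num, mul_pow]
  field_simp

lemma bb_eq (n k : ℕ) : bb n k = Ring.choose (((4 * k - 1 : ℤ) : ℚ) / 4) n := by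
  rw [choose_quarter, bb]; push_cast; rfl

lemma bb_mem (n k : ℕ) : 8 ^ n * bb n k ∈ ZS := by
  rw [bb_eq]; exact choose_quarter_mem _ _

lemma lcm_div_mem (n a : ℕ) (h1 : 1 ≤ a) (h2 : a ≤ n) : (Nat.lcmUpto n : ℚ) / a ∈ ZS := by
  have : a ∣ Nat.lcmUpto n := Finset.dvd_lcm (f := id) (Finset.mem_Icc.mpr ⟨h1, h2⟩)
  have := ZS_div (Nat.lcmUpto n) a (by exact_mod_cast this)
  rwa [Int.cast_natCast, Int.cast_natCast] at this

lemma lcm_sub_mem (n i j : ℕ) (h1 : i ≤ n) (h2 : j ≤ n) :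
    (Nat.lcmUpto n : ℚ) * ((i:ℚ) - j)⁻¹ ∈ ZS := by
  rw [← div_eq_mul_inv]
  rcases lt_trichotomy i j with h | h | h
  · have := ZS.neg_mem (lcm_div_mem n (j - i) (by omega) (by omega))
    rw [Nat.cast_sub h.le] at this
    convert this using 1
    rw [← div_neg]; ring
  · subst h; simp [ZS.zero_mem]
  · have := (lcm_div_mem n (i - j) (by omega) (by omega))
    rwa [Nat.cast_sub h.le] at this

/-- `8^a d binom(c/4,a)/c` is an even integer. -/
lemma choose_div_mem (n a : ℕ) (c : ℤ) (hc : (c:ℚ) ≠ 0) (h2 : a + 1 ≤ n) :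
    8 ^ (a + 1) * (Nat.lcmUpto n : ℚ) * Ring.choose ((c:ℚ) / 4) (a + 1) * (c:ℚ)⁻¹ / 2 ∈ ZS := by
  have h := ZS.mul_mem (lcm_div_mem n (a + 1) (by omega) h2) (choose_quarter_mem (c - 4) a)
  convert h using 1
  rw [choose_quarter, choose_quarter, Finset.prod_range_succ', Nat.factorial_succ]
  have : ∀ i ∈ Finset.range a, ((c:ℚ) - 4 * ((i + 1 : ℕ) : ℚ)) = ((c - 4 : ℤ) : ℚ) - 4 * i := by
    intro i _; push_cast; ring
  rw [Finset.prod_congr rfl this]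
  push_cast
  have hf := Nat.factorial_ne_zero a
  have : (a:ℚ) + 1 ≠ 0 := by positivity
  rw [pow_succ, pow_succ]
  field_simp
  ring

lemma bb_div_mem (n k i : ℕ) (hi : i < n) :
    8 ^ n * (Nat.lcmUpto n : ℚ) * bb n k * (4 * (k:ℚ) - 1 - 4 * i)⁻¹ / 2 ∈ ZS := by
  set c : ℤ := 4 * k - 1 - 4 * i with hcdef
  have hc : (4 * (k:ℚ) - 1 - 4 * i) = (c:ℚ) := by rw [hcdef]; push_cast; ring
  have hc0 : (c:ℚ) ≠ 0 := by rw [← hc]; exact num_ne k i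
  have e : bb n k = ∑ x ∈ Finset.range n, Ring.choose ((c:ℚ) / 4) (x + 1) * (i.choose (n - (x + 1)) : ℚ) := by
    rw [bb_eq, show (((4 * k - 1 : ℤ) : ℚ) / 4) = (c:ℚ) / 4 + (i:ℚ) by rw [← hc]; push_cast; ring,
      Ring.add_choose_eq n (Commute.all _ _), Finset.Nat.sum_antidiagonal_eq_sum_range_succ_mk,
      Finset.sum_range_succ']
    simp only [Ring.choose_natCast]
    simp [Nat.choose_eq_zero_of_lt hi]
  rw [hc, e, Finset.mul_sum, Finset.sum_mul, Finset.sum_div]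
  refine ZS.sum_mem (fun x hx => ?_)
  have hx' : x < n := by simpa using hx
  have h := ZS.mul_mem (ZS.mul_mem (choose_div_mem n x c hc0 (by omega)) (ZS_nat (i.choose (n - (x + 1)))))
    (ZS_nat (8 ^ (n - (x + 1))))
  convert h using 1
  have : (8:ℚ) ^ n = 8 ^ (x + 1) * 8 ^ (n - (x + 1)) := by rw [← pow_add]; congr 1; omega
  rw [this]; push_cast; ring

lemma bb_div2_mem (n k i j : ℕ) (hi : i < n) (hj : j < n) (hij : i ≠ j) :
    8 ^ n * (Nat.lcmUpto n : ℚ) ^ 2 * bb n k * ((4 * (k:ℚ) - 1 - 4 * i)⁻¹ * (4 * (k:ℚ) - 1 - 4 * j)⁻¹) * 2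
      ∈ ZS := by
  have h1 := bb_div_mem n k i hi
  have h2 := bb_div_mem n k j hj
  have h3 := lcm_sub_mem n i j hi.le hj.le
  have h := ZS.mul_mem (ZS.sub_mem h1 h2) h3
  convert h using 1
  have h4 := num_ne k i
  have h5 := num_ne k j
  have h6 : (i:ℚ) - j ≠ 0 := sub_ne_zero.mpr (by exact_mod_cast hij)
  have : (4 * (k:ℚ) - 1 - 4 * i)⁻¹ * (4 * (k:ℚ) - 1 - 4 * j)⁻¹ =
    ((4 * (k:ℚ) - 1 - 4 * i)⁻¹ - (4 * (k:ℚ) - 1 - 4 * j)⁻¹) * ((i:ℚ) - j)⁻¹ / 4 := by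
    field_simp
    ring
  rw [this]; ring

lemma qn_mem (n : ℕ) : 64 ^ n * (Nat.lcmUpto n : ℚ) ^ 3 * qn n ∈ ZS := by
  unfold qn
  rw [Finset.mul_sum]
  refine ZS.sum_mem (fun k hk => ?_)
  have hk' : k < n + 1 := by simpa using hk
  rw [EE_sq n k (by omega)]
  have h := ZS.mul_mem (ZS.pow_mem (ZS_nat (Nat.lcmUpto n)) 3)
    (ZS.pow_mem (ZS.mul_mem (ZS_nat (n.choose k)) (bb_mem n k)) 2)
  convert h using 1
  rw [show (64:ℚ) = 8 ^ 2 by norm_num, ← pow_mul]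
  ring

lemma pn_term_mem (n k m : ℕ) (hk : k ≤ n) (hm : m < k) :
    64 ^ n * (Nat.lcmUpto n : ℚ) ^ 3 * (EE n k ^ 2 * (8 / (1 - 4 * ((m:ℚ) + 1)) ^ 3) +
    2 * EE n k ^ 2 * LL n k * (4 / (1 - 4 * ((m:ℚ) + 1)) ^ 2)) ∈ ZS := by
  set d := (Nat.lcmUpto n : ℚ) with hd
  set i0 := k - (m + 1) with hi0
  have hi0n : i0 < n := by omega
  set w : ℕ → ℚ := fun i => (4 * (k:ℚ) - 1 - 4 * i)⁻¹ with hw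
  have hw0 : (1 - 4 * ((m:ℚ) + 1))⁻¹ = - w i0 := by
    simp only [hw]
    rw [← inv_neg, hi0, Nat.cast_sub (by omega)]
    push_cast; congr 1; ring
  have hL : LL n k = w i0 + ∑ i ∈ (Finset.range n).erase i0, w i -
      ∑ i ∈ Finset.range (n + 1), (4 * (k:ℚ) - 4 * i)⁻¹ := by
    rw [Finset.add_sum_erase _ _ (Finset.mem_range.mpr hi0n), LL]
  have e : 64 ^ n * d ^ 3 * (EE n k ^ 2 * (8 / (1 - 4 * ((m:ℚ) + 1)) ^ 3) +
    2 * EE n k ^ 2 * LL n k * (4 / (1 - 4 * ((m:ℚ) + 1)) ^ 2)) =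
     (n.choose k : ℚ) ^ 2 * (
      ∑ i ∈ (Finset.range n).erase i0, 8 * (8 ^ n * d * bb n k * w i0 / 2) *
         (8 ^ n * d ^ 2 * bb n k * (w i0 * w i) * 2) -
      ∑ i ∈ Finset.range (n + 1), 8 * (8 ^ n * d * bb n k * w i0 / 2) ^ 2 * (d * ((k:ℚ) - i)⁻¹)) := by
    have e1 : ∑ i ∈ (Finset.range n).erase i0, 8 * (8 ^ n * d * bb n k * w i0 / 2) *
         (8 ^ n * d ^ 2 * bb n k * (w i0 * w i) * 2) =
         8 * 64 ^ n * d ^ 3 * bb n k ^ 2 * w i0 ^ 2 * ∑ i ∈ (Finset.range n).erase i0, w i := by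
      rw [Finset.mul_sum]
      refine Finset.sum_congr rfl (fun i _ => ?_)
      rw [show (64:ℚ) = 8 ^ 2 by norm_num, ← pow_mul]
      ring
    have e2 : ∑ i ∈ Finset.range (n + 1), 8 * (8 ^ n * d * bb n k * w i0 / 2) ^ 2 * (d * ((k:ℚ) - i)⁻¹) =
         8 * 64 ^ n * d ^ 3 * bb n k ^ 2 * w i0 ^ 2 *
           ∑ i ∈ Finset.range (n + 1), (4 * (k:ℚ) - 4 * i)⁻¹ := by
      rw [Finset.mul_sum]
      refine Finset.sum_congr rfl (fun i _ => ?_)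
      rw [show (64:ℚ) = 8 ^ 2 by norm_num, ← pow_mul, ← mul_sub, mul_inv]
      ring
    rw [e1, e2, EE_sq n k hk, hL, div_eq_mul_inv, div_eq_mul_inv, ← inv_pow, ← inv_pow, hw0]
    ring
  rw [e]
  refine ZS.mul_mem (ZS.pow_mem (ZS_nat _) 2) (ZS.sub_mem (ZS.sum_mem fun i hi => ?_)
    (ZS.sum_mem fun i hi => ?_))
  · have hi1 := Finset.ne_of_mem_erase hi
    have hi2 := Finset.mem_range.mp (Finset.mem_of_mem_erase hi)
    exact ZS.mul_mem (ZS.mul_mem (ZS_nat 8) (bb_div_mem n k i0 hi0n)) (bb_div2_mem n k i0 i hi0n hi2 hi1.symm)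
  · have hi2 := Finset.mem_range.mp hi
    exact ZS.mul_mem (ZS.mul_mem (ZS_nat 8) (ZS.pow_mem (bb_div_mem n k i0 hi0n) 2))
      (lcm_sub_mem n k i hk (by omega))

lemma pn_mem (n : ℕ) : 64 ^ n * (Nat.lcmUpto n : ℚ) ^ 3 * pn n ∈ ZS := by
  unfold pn
  rw [Finset.mul_sum]
  refine ZS.sum_mem (fun k hk => ?_)
  rw [Finset.mul_sum]
  refine ZS.sum_mem (fun m hm => ?_)
  have hk' : k < n + 1 := by simpa using hk
  exact pn_term_mem n k m (by omega) (by simpa using hm)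

lemma two_pow_dvd_factorial (k : ℕ) : 2 ^ (2 ^ k - 1) ∣ (2 ^ k).factorial := by
  rw [pow_dvd_iff_le_emultiplicity]
  induction k with
  | zero => simp
  | succ k ih =>
    rw [pow_succ', Nat.prime_two.emultiplicity_factorial_mul]
    have h1 := Nat.one_le_two_pow (n := k)
    have : 2 * 2 ^ k - 1 = (2 ^ k - 1) + 2 ^ k := by omega
    rw [this]
    push_cast
    push_cast at ih
    gcongr

lemma norm_factorial_le (k : ℕ) :
    ‖((2 ^ k - 1).factorial : ℚ_[2])‖ ≤ 2 ^ k * (2 ^ (2 ^ k - 1))⁻¹ := by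
  obtain ⟨c, hc⟩ := two_pow_dvd_factorial k
  have h1 := Nat.one_le_two_pow (n := k)
  have h2 : (2 ^ k).factorial = 2 ^ k * (2 ^ k - 1).factorial := by
    rw [Nat.mul_factorial_pred (by omega)]
  have h3 := congrArg (fun q : ℕ => ‖(q : ℚ_[2])‖) (h2.symm.trans hc)
  simp only [Nat.cast_mul, norm_mul, Nat.cast_pow, Nat.cast_ofNat, norm_two_pow] at h3
  have h4 := norm_nat_le c
  have h5 : ((2:ℝ) ^ k)⁻¹ * ‖((2 ^ k - 1).factorial : ℚ_[2])‖ ≤ (2 ^ (2 ^ k - 1))⁻¹ := by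
    rw [h3]; exact mul_le_of_le_one_right (by positivity) h4
  rwa [inv_mul_le_iff₀ (by positivity)] at h5

lemma one_le_abs_mul_norm (z : ℤ) (hz : z ≠ 0) : 1 ≤ |(z:ℝ)| * ‖(z : ℚ_[2])‖ := by
  have hz' : (z : ℚ_[2]) ≠ 0 := by exact_mod_cast hz
  obtain ⟨m, hm⟩ : ∃ m : ℕ, ‖(z : ℚ_[2])‖ = ((2:ℕ):ℝ) ^ (-(m:ℤ)) := by
    have hm := Padic.norm_eq_zpow_neg_valuation hz'
    generalize (z : ℚ_[2]).valuation = m at hm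
    rcases Int.eq_nat_or_neg m with ⟨j, rfl | rfl⟩
    · exact ⟨j, hm⟩
    · have h1 := Padic.norm_int_le_one (p := 2) z
      rw [hm, neg_neg, zpow_natCast] at h1
      refine ⟨0, ?_⟩
      rw [hm, neg_neg, zpow_natCast]
      have : (1:ℝ) ≤ ((2:ℕ):ℝ) ^ j := one_le_pow₀ (by norm_num)
      simp only [Nat.cast_zero, neg_zero, zpow_zero]
      linarith
  have hd := (Padic.norm_int_le_pow_iff_dvd (p := 2) z m).mp hm.le
  have h2 := Int.le_of_dvd (abs_pos.mpr hz) ((dvd_abs _ _).mpr hd)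
  have h3 : (2:ℝ) ^ m ≤ |(z:ℝ)| := by exact_mod_cast h2
  rw [hm, zpow_neg, zpow_natCast, ← div_eq_mul_inv, le_div_iff₀ (by positivity), one_mul]
  exact_mod_cast h3

lemma main_ineq (r : ℚ) (hT : Filter.Tendsto TT Filter.atTop (nhds (4 * (r : ℚ_[2])))) (k : ℕ)
    (hk : 1 ≤ k) : (64:ℝ) ^ (2 ^ k - 1) ≤ (r.den * (4 * |(r:ℝ)| + 16)) *
      (((2 ^ k - 1 : ℕ) : ℝ) + 1) ^ 10 * (Nat.lcmUpto (2 ^ k - 1) : ℝ) ^ 3 := by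
  have hn := norm_form r hT k hk
  have h1k := Nat.one_le_two_pow (n := k)
  have hfac := norm_factorial_le k
  set n := 2 ^ k - 1 with hndef
  have hn1 : ((2:ℝ) ^ k) = (n:ℝ) + 1 := by
    have : 2 ^ k = n + 1 := by omega
    exact_mod_cast this
  set X : ℚ := qn n * (4 * r) + pn n with hX
  set d := Nat.lcmUpto n with hd
  have hXn : ‖(X : ℚ_[2])‖ = ‖(4 ^ n * n.factorial : ℚ_[2])‖ ^ 2 * 2 ^ k := by
    rw [← hn, hX]; push_cast; rfl
  have hZ : (r.den : ℚ) * (64 ^ n * (d:ℚ) ^ 3 * X) ∈ ZS := by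
    have h1 := ZS.mul_mem (qn_mem n) (ZS_int (4 * r.num))
    have h2 := ZS.mul_mem (pn_mem n) (ZS_nat r.den)
    have h := ZS.add_mem h1 h2
    convert h using 1
    have : (r.num : ℚ) = r * r.den := (Rat.mul_den_eq_num r).symm
    push_cast
    rw [this, hX]; ring
  obtain ⟨z, hz⟩ := hZ
  have hz : (z:ℚ) = (r.den : ℚ) * (64 ^ n * (d:ℚ) ^ 3 * X) := hz
  have hX0 : X ≠ 0 := by
    intro h0
    rw [h0] at hXn
    simp only [Rat.cast_zero, norm_zero] at hXn
    have h4 : (4 ^ n * n.factorial : ℚ_[2]) ≠ 0 := by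
      have : 4 ^ n * n.factorial ≠ 0 := mul_ne_zero (by positivity) (Nat.factorial_ne_zero n)
      exact_mod_cast this
    have := norm_pos_iff.mpr h4
    have : 0 < ‖(4 ^ n * n.factorial : ℚ_[2])‖ ^ 2 * 2 ^ k := by positivity
    linarith
  have hd0 : (d:ℚ) ≠ 0 := by exact_mod_cast Nat.lcmUpto_ne_zero n
  have hden : (r.den : ℚ) ≠ 0 := by exact_mod_cast r.den_ne_zero
  have hz0 : z ≠ 0 := by
    have : (z:ℚ) ≠ 0 := by rw [hz]; positivity
    exact_mod_cast this
  have hnz : ‖(z : ℚ_[2])‖ ≤ ((n:ℝ) + 1) ^ 3 * (4096 ^ n)⁻¹ := by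
    have e : (z : ℚ_[2]) = (r.den : ℚ_[2]) * (2 ^ (6 * n) * (d:ℚ_[2]) ^ 3 * (X : ℚ_[2])) := by
      have := congrArg (fun q : ℚ => (q : ℚ_[2])) hz
      push_cast at this
      rw [this, pow_mul]; norm_num
    have e4 : ‖(4 ^ n * n.factorial : ℚ_[2])‖ = (2 ^ (2 * n))⁻¹ * ‖(n.factorial : ℚ_[2])‖ := by
      rw [norm_mul, show (4:ℚ_[2]) = 2 ^ 2 by norm_num, ← pow_mul, norm_two_pow]
    rw [e]
    simp only [norm_mul, norm_pow (d : ℚ_[2])]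
    rw [hXn, e4, norm_two_pow]
    have g1 := norm_nat_le r.den
    have g2 := norm_nat_le d
    rw [hn1] at hfac ⊢
    calc _ ≤ 1 * ((2 ^ (6 * n))⁻¹ * 1 ^ 3 * (((2 ^ (2 * n))⁻¹ * (((n:ℝ) + 1) * (2 ^ n)⁻¹)) ^ 2 * ((n:ℝ) + 1))) := by
          gcongr
      _ = ((n:ℝ) + 1) ^ 3 * (4096 ^ n)⁻¹ := by
          rw [show (4096:ℝ) = 2 ^ 12 by norm_num, ← pow_mul]
          have : (2:ℝ) ^ (12 * n) = 2 ^ (6 * n) * (2 ^ (2 * n) * 2 ^ n) ^ 2 := by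
            rw [← pow_add, ← pow_mul, ← pow_add]; congr 1; ring
          rw [this]
          field_simp
  have hup : |(z:ℝ)| ≤ r.den * (64 ^ n * (d:ℝ) ^ 3 * ((4 * |(r:ℝ)| + 16) * ((n:ℝ) + 1) ^ 3)) := by
    have e : (z : ℝ) = (r.den : ℝ) * (64 ^ n * (d:ℝ) ^ 3 * (X : ℝ)) := by
      have := congrArg (fun q : ℚ => (q : ℝ)) hz
      push_cast at this
      exact this
    have hXle : |(X:ℝ)| ≤ (4 * |(r:ℝ)| + 16) * ((n:ℝ) + 1) ^ 3 := by
      have hq : |(qn n : ℝ)| ≤ n + 1 := by exact_mod_cast qn_le n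
      have hp : |(pn n : ℝ)| ≤ 16 * (n + 1) ^ 3 := by exact_mod_cast pn_le n
      rw [hX]; push_cast
      refine (abs_add_le _ _).trans ?_
      rw [abs_mul, abs_mul, abs_of_nonneg (by norm_num : (0:ℝ) ≤ 4)]
      have hge : (n:ℝ) + 1 ≤ ((n:ℝ) + 1) ^ 3 :=
        le_self_pow₀ (by have : (0:ℝ) ≤ n := by positivity
                         linarith) (by norm_num)
      calc _ ≤ ((n:ℝ) + 1) ^ 3 * (4 * |(r:ℝ)|) + 16 * (n + 1) ^ 3 := by
            gcongr; exact hq.trans hge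
        _ = _ := by ring
    rw [e, abs_mul, abs_mul, abs_of_nonneg (by positivity : (0:ℝ) ≤ r.den),
      abs_of_nonneg (by positivity : (0:ℝ) ≤ 64 ^ n * (d:ℝ) ^ 3)]
    gcongr
  have hone := one_le_abs_mul_norm z hz0
  have h1 : 1 ≤ (r.den * (64 ^ n * (d:ℝ) ^ 3 * ((4 * |(r:ℝ)| + 16) * ((n:ℝ) + 1) ^ 3))) *
      (((n:ℝ) + 1) ^ 3 * (4096 ^ n)⁻¹) := by
    refine hone.trans ?_
    gcongr
  have h2 : (64:ℝ) ^ n ≤ (r.den * (4 * |(r:ℝ)| + 16)) * ((n:ℝ) + 1) ^ 6 * (d : ℝ) ^ 3 := by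
    have e : (r.den * (64 ^ n * (d:ℝ) ^ 3 * ((4 * |(r:ℝ)| + 16) * ((n:ℝ) + 1) ^ 3))) *
      (((n:ℝ) + 1) ^ 3 * (4096 ^ n)⁻¹) =
       ((r.den * (4 * |(r:ℝ)| + 16)) * ((n:ℝ) + 1) ^ 6 * (d : ℝ) ^ 3) / 64 ^ n := by
      rw [show (4096:ℝ) = 64 * 64 by norm_num, mul_pow]
      field_simp
    rw [e, le_div_iff₀ (by positivity), one_mul] at h1
    exact h1
  refine h2.trans ?_
  have : ((n:ℝ) + 1) ^ 6 ≤ ((n:ℝ) + 1) ^ 10 :=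
    pow_le_pow_right₀ (by have : (0:ℝ) ≤ n := by positivity
                          linarith) (by norm_num)
  gcongr

theorem stmt_3 (η : ℚ_[2])
    (hη : ∃ k : ℕ → ℕ, (∀ j, 0 < k j) ∧
      Filter.Tendsto (fun j => (k j : ℝ)) Filter.atTop Filter.atTop ∧
      Filter.Tendsto (fun j => ‖(k j : ℚ_[2]) + 1‖) Filter.atTop (nhds 0) ∧
      Filter.Tendsto
        (fun j => ((-((1 - (2 : ℚ) ^ (2 * k j - 1)) * bernoulli (2 * k j) / (2 * k j)) : ℚ) : ℚ_[2]))
        Filter.atTop (nhds η)) :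
    ∀ r : ℚ, η ≠ (r : ℚ_[2]) := by
  intro r hr
  obtain ⟨k, hk0, _, h1, h2⟩ := hη
  have hT := tendsto_TT η k hk0 h1 h2
  rw [hr] at hT
  have hC : (0:ℝ) < r.den * (4 * |(r:ℝ)| + 16) := by
    have : (0:ℝ) < r.den := by exact_mod_cast r.den_pos
    positivity
  obtain ⟨n0, hn0⟩ := Filter.eventually_atTop.mp (eventually_small _ hC)
  have hlt : n0 + 1 < 2 ^ (n0 + 1) := Nat.lt_two_pow_self
  have h3 := hn0 (2 ^ (n0 + 1) - 1) (by omega)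
  have h4 := main_ineq r hT (n0 + 1) (by omega)
  linarith
end
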